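/- arXiv:2510.23841 — 3 statements merged into one kernel-verified Lean document; each statement's English description precedes it below -/
import Mathlib

section
/- Let G be a finite group such that exactly two elements of cs(G) are composite numbers. Then cs(G) contains at most three prime numbers. -/
/-- The set of conjugacy class sizes of a group `G`. -/
def csSet (G : Type*) [Group G] : Set ℕ :=
  {n | ∃ g : G, n = (Subgroup.centralizer {g} : Subgroup G).index}

/-- A natural number is composite if it is greater than 1 and not prime. -/
def IsCompositeNat (n : ℕ) : Prop := 1 < n ∧ ¬ n.Prime

theorem ncard_range_eq_index {G α : Type*} [Group G] (H : Subgroup G) (f : G → α)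
    (hf : ∀ g h, f g = f h ↔ g⁻¹ * h ∈ H) : (Set.range f).ncard = H.index := by
  rw [Subgroup.index_eq_card, ← Nat.card_coe_set_eq]
  symm
  refine Nat.card_congr (Equiv.ofBijective
    (fun a : G ⧸ H => Quotient.liftOn' a (fun g => (⟨f g, g, rfl⟩ : Set.range f)) ?_) ⟨?_, ?_⟩)
  · intro g h hgh
    exact Subtype.ext ((hf g h).2 (QuotientGroup.leftRel_apply.1 hgh))
  · intro a b
    refine Quotient.inductionOn₂' a b ?_
    intro g h hgh
    apply Quotient.sound'
    exact QuotientGroup.leftRel_apply.2 ((hf g h).1 (congrArg Subtype.val hgh))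
  · rintro ⟨_, g, rfl⟩
    exact ⟨Quotient.mk'' g, rfl⟩

theorem conj_eq_iff_mem {G : Type*} [Group G] (x g h : G) :
    g * x * g⁻¹ = h * x * h⁻¹ ↔ g⁻¹ * h ∈ Subgroup.centralizer {x} := by
  rw [Subgroup.mem_centralizer_singleton_iff]
  constructor
  · intro e
    have : x = g⁻¹ * (h * x * h⁻¹) * g := by rw [← e]; group
    calc g⁻¹ * h * x = g⁻¹ * (h * x * h⁻¹) * g * (g⁻¹ * h) := by group
      _ = x * (g⁻¹ * h) := by rw [← this]
  · intro e
    have : h * x = g * x * g⁻¹ * h := by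
      calc h * x = g * (g⁻¹ * h * x) := by group
        _ = _ := by rw [e]; group
    rw [this]; group

theorem ncard_conj {G : Type*} [Group G] (x : G) :
    (Set.range fun g : G => g * x * g⁻¹).ncard = (Subgroup.centralizer {x}).index :=
  ncard_range_eq_index _ _ (conj_eq_iff_mem x)

theorem card_dvd_of_mul_mem {G : Type*} [Group G] [Finite G] (N : Subgroup G) (S : Set G)
    (h : ∀ n ∈ N, ∀ z ∈ S, n * z ∈ S) : Nat.card N ∣ S.ncard := by
  let act : MulAction N S :=
    { smul := fun n z => ⟨n.1 * z.1, h n.1 n.2 z.1 z.2⟩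
      one_smul := fun z => Subtype.ext (one_mul z.1)
      mul_smul := fun a b z => Subtype.ext (mul_assoc a.1 b.1 z.1) }
  have e := MulAction.selfEquivOrbitsQuotientProd (G := N) (X := S) (by
    intro z
    rw [eq_bot_iff]
    intro n hn
    have h1 : n.1 * z.1 = z.1 := congrArg Subtype.val (MulAction.mem_stabilizer_iff.1 hn)
    rw [Subgroup.mem_bot]
    exact Subtype.ext (by simpa using h1))
  rw [← Nat.card_coe_set_eq, Nat.card_congr e, Nat.card_prod]
  exact dvd_mul_left _ _

def cN {G : Type*} [Group G] (x : G) : Subgroup G :=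
  Subgroup.closure (Set.range fun g : G => x⁻¹ * (g * x * g⁻¹))

open scoped Pointwise in
theorem key {G : Type*} [Group G] [Finite G] (x y : G) {p q : ℕ} (hp : p.Prime) (hq : q.Prime)
    (hpq : p < q) (hx : p = (Subgroup.centralizer {x}).index)
    (hy : q = (Subgroup.centralizer {y}).index) :
    p * q ∈ csSet G ∨ Nat.card (cN x) = q := by
  set A := Subgroup.centralizer {x}
  set B := Subgroup.centralizer {y}
  have hcop : Nat.Coprime p q := (Nat.coprime_primes hp hq).2 hpq.ne
  have hAB : (A ⊓ B).index = p * q := by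
    apply le_antisymm
    · rw [hx, hy]; exact Subgroup.index_inf_le
    · apply Nat.le_of_dvd (Nat.pos_of_ne_zero Subgroup.index_ne_zero_of_finite)
      apply hcop.mul_dvd_of_dvd_of_dvd
      · rw [hx]; exact Subgroup.index_dvd_of_le inf_le_left
      · rw [hy]; exact Subgroup.index_dvd_of_le inf_le_right
  -- simultaneous conjugacy
  have hpair : (Set.range fun g : G => (g * x * g⁻¹, g * y * g⁻¹)) =
      (Set.range fun g : G => g * x * g⁻¹) ×ˢ (Set.range fun g : G => g * y * g⁻¹) := by
    apply Set.eq_of_subset_of_ncard_le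
    · rintro _ ⟨g, rfl⟩
      exact ⟨⟨g, rfl⟩, ⟨g, rfl⟩⟩
    · rw [Set.ncard_prod, ncard_conj, ncard_conj,
        ncard_range_eq_index (A ⊓ B) (fun g : G => (g * x * g⁻¹, g * y * g⁻¹)), hAB, hx, hy]
      intro g h
      rw [Prod.mk.injEq, conj_eq_iff_mem, conj_eq_iff_mem, Subgroup.mem_inf]
    · exact Set.toFinite _
  have hprod : ∀ g h : G, (g * x * g⁻¹) * (h * y * h⁻¹) ∈
      Set.range fun k : G => k * (x * y) * k⁻¹ := by
    intro g h
    have : (g * x * g⁻¹, h * y * h⁻¹) ∈ (Set.range fun g : G => (g * x * g⁻¹, g * y * g⁻¹)) := by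
      rw [hpair]; exact ⟨⟨g, rfl⟩, ⟨h, rfl⟩⟩
    obtain ⟨k, hk⟩ := this
    simp only [Prod.mk.injEq] at hk
    refine ⟨k, ?_⟩
    rw [← hk.1, ← hk.2]
    group
  set S := Set.range fun g : G => g * y * g⁻¹ with hS
  set T := Set.range fun k : G => k * (x * y) * k⁻¹ with hT
  have hSc : S.ncard = q := by rw [hS, ncard_conj, hy]
  have hTc : T.ncard = (Subgroup.centralizer {x * y}).index := ncard_conj _
  have hsub : ((fun z => x * z) '' S) ⊆ T := by
    rintro _ ⟨_, ⟨h, rfl⟩, rfl⟩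
    simpa using hprod 1 h
  have himg : ((fun z => x * z) '' S).ncard = q := by
    rw [Set.ncard_image_of_injective _ (mul_right_injective x), hSc]
  have hle : q ≤ T.ncard := by
    rw [← himg]; exact Set.ncard_le_ncard hsub (Set.toFinite _)
  have hdvd : T.ncard ∣ p * q := by
    rw [hTc, ← hAB]
    apply Subgroup.index_dvd_of_le
    intro c hc
    obtain ⟨h1, h2⟩ := Subgroup.mem_inf.1 hc
    rw [Subgroup.mem_centralizer_singleton_iff] at h1 h2 ⊢
    rw [← mul_assoc, h1, mul_assoc, h2, mul_assoc]
  have hcases : T.ncard = p * q ∨ T.ncard = q := by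
    obtain ⟨d, e, hd, he, hde⟩ := (Nat.dvd_mul).1 hdvd
    rcases (Nat.dvd_prime hp).1 hd with rfl | rfl <;>
      rcases (Nat.dvd_prime hq).1 he with rfl | rfl
    · have := hq.two_le; omega
    · right; omega
    · omega
    · left; exact hde.symm
  rcases hcases with h | h
  · left
    exact ⟨x * y, by rw [← h, hTc]⟩
  · right
    have heq : ((fun z => x * z) '' S) = T :=
      Set.eq_of_subset_of_ncard_le hsub (by rw [himg, h]) (Set.toFinite _)
    have hN : ∀ n ∈ cN x, ∀ z ∈ S, n * z ∈ S := by
      have : cN x ≤ (MulAction.stabilizer G S) := by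
        rw [cN, Subgroup.closure_le]
        rintro _ ⟨g, rfl⟩
        rw [SetLike.mem_coe, MulAction.mem_stabilizer_iff]
        apply Set.eq_of_subset_of_ncard_le
        · rintro _ ⟨_, ⟨k, rfl⟩, rfl⟩
          have := hprod g k
          rw [← heq] at this
          obtain ⟨z, hz, hz2⟩ := this
          have h3 : z = (x⁻¹ * (g * x * g⁻¹)) • (k * y * k⁻¹) := by
            rw [smul_eq_mul, mul_assoc, ← hz2]; simp
          rw [h3] at hz; exact hz
        · rw [← Set.image_smul, Set.ncard_image_of_injective _ (MulAction.injective _)]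
        · exact Set.toFinite _
      intro n hn z hz
      have h1 := MulAction.mem_stabilizer_iff.1 (this hn)
      rw [← h1]
      exact ⟨z, hz, rfl⟩
    have hd := card_dvd_of_mul_mem _ _ hN
    rw [hSc] at hd
    rcases (Nat.dvd_prime hq).1 hd with h1 | h1
    · exfalso
      rw [Subgroup.card_eq_one] at h1
      have : A = ⊤ := by
        rw [eq_top_iff]
        intro g _
        have hm : x⁻¹ * (g * x * g⁻¹) ∈ cN x := Subgroup.subset_closure ⟨g, rfl⟩
        rw [h1, Subgroup.mem_bot, inv_mul_eq_one] at hm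
        rw [Subgroup.mem_centralizer_singleton_iff]
        conv_rhs => rw [hm]
        group
      rw [this, Subgroup.index_top] at hx
      exact hp.ne_one hx
    · exact h1

theorem arith {C : Set ℕ} (hC : C.ncard = 2) {a b c d na nb : ℕ} (ha : a.Prime) (hb : b.Prime)
    (hc : c.Prime) (hab : a < b) (hbc : b < c) (hcd : c < d)
    (h1 : a * b ∈ C ∨ na = b) (h2 : a * c ∈ C ∨ na = c) (h3 : a * d ∈ C ∨ na = d)
    (h4 : b * c ∈ C ∨ nb = c) (h5 : b * d ∈ C ∨ nb = d) : False := by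
  obtain ⟨u, v, -, rfl⟩ := Set.ncard_eq_two.1 hC
  simp only [Set.mem_insert_iff, Set.mem_singleton_iff] at h1 h2 h3 h4 h5
  have pa := ha.pos
  have pb := hb.pos
  have i1 : a * b < a * c := Nat.mul_lt_mul_of_pos_left hbc pa
  have i2 : a * c < a * d := Nat.mul_lt_mul_of_pos_left hcd pa
  have i3 : b * c < b * d := Nat.mul_lt_mul_of_pos_left hcd pb
  have i4 : a * c < b * c := Nat.mul_lt_mul_of_pos_right hab hc.pos
  have i5 : a * d < b * d := Nat.mul_lt_mul_of_pos_right hab (by omega)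
  have i6 : a * d ≠ b * c := by
    intro h
    rcases ha.dvd_mul.1 (Dvd.intro _ h) with h | h
    · have := (Nat.prime_dvd_prime_iff_eq ha hb).1 h; omega
    · have := (Nat.prime_dvd_prime_iff_eq ha hc).1 h; omega
  generalize a * b = ab at *
  generalize a * c = ac at *
  generalize a * d = ad at *
  generalize b * c = bc at *
  generalize b * d = bd at *
  omega

/-- If a finite group has exactly two composite conjugacy class sizes, then it has at most
three prime conjugacy class sizes. -/
theorem stmt_0 (G : Type*) [Group G] [Finite G]
    (hcomp : {n ∈ csSet G | IsCompositeNat n}.ncard = 2) :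
    {n ∈ csSet G | n.Prime}.ncard ≤ 3 := by
  by_contra hcon
  obtain ⟨t, hts, htc⟩ := Set.exists_subset_card_eq (s := {n ∈ csSet G | n.Prime}) (n := 4)
    (by omega)
  have htf : t.Finite := Set.finite_of_ncard_ne_zero (by omega)
  have hcard : htf.toFinset.card = 4 := by rw [← Set.ncard_eq_toFinset_card t htf, htc]
  let f := htf.toFinset.orderEmbOfFin hcard
  have hf : ∀ i, f i ∈ csSet G ∧ (f i).Prime := fun i =>
    hts (htf.mem_toFinset.1 (Finset.orderEmbOfFin_mem _ hcard i))
  have hlt : ∀ i j, i < j → f i < f j := fun i j h => f.strictMono h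
  choose x hx using fun i => (hf i).1
  have hk : ∀ i j, i < j →
      f i * f j ∈ {n ∈ csSet G | IsCompositeNat n} ∨ Nat.card (cN (x i)) = f j := by
    intro i j hij
    refine (key (x i) (x j) (hf i).2 (hf j).2 (hlt i j hij) (hx i) (hx j)).imp_left ?_
    intro h
    refine ⟨h, ?_, Nat.not_prime_mul (hf i).2.ne_one (hf j).2.ne_one⟩
    have := (hf i).2.two_le
    have := (hf j).2.two_le
    nlinarith
  exact arith hcomp (hf 0).2 (hf 1).2 (hf 2).2 (hlt 0 1 (by decide)) (hlt 1 2 (by decide))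
    (hlt 2 3 (by decide)) (hk 0 1 (by decide)) (hk 0 2 (by decide)) (hk 0 3 (by decide))
    (hk 1 2 (by decide)) (hk 1 3 (by decide))
end

section
/- Let G be a finite group with cs(G) = {1, p_1, p_2, p_3, m, n}, where p_1, p_2, p_3 are distinct primes and m, n are the unique composite numbers in cs(G). Then there is a relabelling (i, j, k) of (1, 2, 3) such that m = p_i·p_j and n = p_i·p_k. -/
namespace CsAux
open Subgroup

variable {G : Type*} [Group G]

abbrev Cz (x : G) : Subgroup G := Subgroup.centralizer {x}

lemma mem_Cz {x g : G} : g ∈ Cz x ↔ g * x = x * g := by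
  rw [Subgroup.mem_centralizer_singleton_iff]

lemma conj_eq {x g : G} (h : g ∈ Cz x) : g * x * g⁻¹ = x := by
  rw [mem_Cz.1 h]; group

lemma mem_Cz' {x g : G} (h : g * x * g⁻¹ = x) : g ∈ Cz x := by
  rw [mem_Cz]; exact mul_inv_eq_iff_eq_mul.1 h

lemma index_inf_of_coprime [Finite G] (H K : Subgroup G) (h : Nat.Coprime H.index K.index) :
    (H ⊓ K).index = H.index * K.index := by
  apply le_antisymm index_inf_le
  apply Nat.le_of_dvd (Nat.pos_of_ne_zero index_ne_zero_of_finite)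
  exact h.mul_dvd_of_dvd_of_dvd (index_dvd_of_le inf_le_left) (index_dvd_of_le inf_le_right)

lemma factor [Finite G] (H K : Subgroup G) (h : (H ⊓ K).index = H.index * K.index) (g : G) :
    ∃ a ∈ H, ∃ b ∈ K, g = a * b := by
  let f : G ⧸ (H ⊓ K) → (G ⧸ H) × (G ⧸ K) := fun c =>
    (Subgroup.quotientMapOfLE inf_le_left c, Subgroup.quotientMapOfLE inf_le_right c)
  have hinj : Function.Injective f := by
    intro a b
    induction a using QuotientGroup.induction_on with | H a => ?_
    induction b using QuotientGroup.induction_on with | H b => ?_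
    intro hab
    have h1 := congrArg Prod.fst hab
    have h2 := congrArg Prod.snd hab
    simp only [f, Subgroup.quotientMapOfLE_apply_mk] at h1 h2
    rw [QuotientGroup.eq] at h1 h2 ⊢
    exact ⟨h1, h2⟩
  have hbij : Function.Bijective f := by
    rw [Nat.bijective_iff_injective_and_card]
    refine ⟨hinj, ?_⟩
    rw [Nat.card_prod]
    exact h
  obtain ⟨c, hc⟩ := hbij.2 (((1 : G) : G ⧸ H), (g : G ⧸ K))
  induction c using QuotientGroup.induction_on with | H a => ?_
  have h1 := congrArg Prod.fst hc
  have h2 := congrArg Prod.snd hc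
  simp only [f, Subgroup.quotientMapOfLE_apply_mk] at h1 h2
  rw [QuotientGroup.eq] at h1 h2
  refine ⟨a, ?_, a⁻¹ * g, h2, by group⟩
  simpa using h1

lemma Cz_lt_top_of_prime {x : G} {p : ℕ} (hp : p.Prime) (hx : (Cz x).index = p) :
    ∃ g : G, g * x * g⁻¹ ≠ x := by
  by_contra! hc
  have : Cz x = ⊤ := by
    rw [eq_top_iff]; intro g _; exact mem_Cz' (hc g)
  rw [this, index_top] at hx
  exact hp.one_lt.ne hx

lemma lemA [Finite G] {x y : G} {p q : ℕ} (hp : p.Prime) (hq : q.Prime) (hpq : p ≠ q)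
    (hx : (Cz x).index = p) (hy : (Cz y).index = q) (hxy : x * y ≠ y * x) : q ∣ orderOf x := by
  have hi : (Cz x ⊓ Cz y).index = p * q := by
    rw [index_inf_of_coprime, hx, hy]
    rw [hx, hy]; exact (Nat.coprime_primes hp hq).2 hpq
  let H := Cz x
  let K : Subgroup H := (Cz y).subgroupOf H
  have hK : K.index = q := by
    have h1 := relIndex_mul_index (inf_le_left : Cz x ⊓ Cz y ≤ Cz x)
    rw [hi, hx, inf_relIndex_left, mul_comm] at h1
    exact Nat.eq_of_mul_eq_mul_left hp.pos h1
  let x' : H := ⟨x, mem_Cz.2 rfl⟩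
  let Z : Subgroup H := zpowers x'
  have hZ : Z ≤ center H := by
    rw [zpowers_le, mem_center_iff]
    intro g
    exact Subtype.ext (mem_Cz.1 g.2)
  haveI : Z.Normal := ⟨fun n hn g => by
    rw [mem_center_iff.1 (hZ hn) g]; simpa using hn⟩
  have hx'K : x' ∉ K := by
    intro h
    exact hxy (mem_Cz.1 (mem_subgroupOf.1 h))
  have htop : K ⊔ Z = ⊤ := by
    have h1 := relIndex_mul_index (le_sup_left : K ≤ K ⊔ Z)
    rw [hK] at h1
    have h2 : (K ⊔ Z).index ∣ q := Dvd.intro_left _ h1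
    rcases (Nat.dvd_prime hq).1 h2 with h3 | h3
    · exact index_eq_one.1 h3
    · exfalso
      rw [h3] at h1
      have h4 : K.relIndex (K ⊔ Z) = 1 := Nat.eq_of_mul_eq_mul_right hq.pos (by simpa using h1)
      rw [relIndex_eq_one] at h4
      exact hx'K (h4 (mem_sup_right (mem_zpowers x')))
  have h1 := relIndex_sup_right (H := K) (K := Z)
  rw [htop, relIndex_top_right] at h1
  have h2 := card_mul_index Z
  have h3 := card_mul_index K
  have h4 := relIndex_mul_relIndex ⊥ (Z ⊓ K) K bot_le inf_le_right
  rw [relIndex_bot_left, relIndex_bot_left, mul_comm] at h4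
  rw [inf_relIndex_right] at h4
  have h5 : Z.index ≠ 0 := index_ne_zero_of_finite
  have h6 : Nat.card Z = Nat.card (Z ⊓ K : Subgroup H) * q := by
    apply Nat.eq_of_mul_eq_mul_right (Nat.pos_of_ne_zero h5)
    rw [h2, ← h3, hK, ← h4, h1]; ring
  have h7 : Nat.card Z = orderOf x := by
    rw [Nat.card_zpowers]
    exact (Subgroup.orderOf_coe x').symm
  rw [← h7, h6]
  exact Dvd.intro_left _ rfl

lemma lemB [Finite G] {x y : G} {p q : ℕ} (hp : p.Prime) (hq : q.Prime) (hpq : p ≠ q)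
    (hx : (Cz x).index = p) (hy : (Cz y).index = q) (hxy : x * y = y * x)
    (hw : (Cz (x * y)).index = q) :
    ∃ D : Subgroup G, D.Normal ∧ Nat.card D = q ∧
      (∀ d, d ∈ D ↔ ∃ g, g * y * g⁻¹ = d * y) ∧ (∀ g, g * x * g⁻¹ * x⁻¹ ∈ D) ∧
      q ∣ orderOf x := by
  have hco : Nat.Coprime p q := (Nat.coprime_primes hp hq).2 hpq
  have hF1 := factor (Cz y) (Cz x) (index_inf_of_coprime _ _ (by rw [hx, hy]; exact hco.symm))
  have hF1' := factor (Cz x) (Cz y) (index_inf_of_coprime _ _ (by rw [hx, hy]; exact hco))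
  have hF2 := factor (Cz (x * y)) (Cz x) (index_inf_of_coprime _ _ (by rw [hx, hw]; exact hco.symm))
  -- S = conjugates of y
  let D : Subgroup G :=
    { carrier := {d | ∀ g, ∃ h, d * (g * y * g⁻¹) = h * y * h⁻¹}
      one_mem' := fun g => ⟨g, by simp⟩
      mul_mem' := by
        intro a b ha hb g
        obtain ⟨h, hh⟩ := hb g
        obtain ⟨k, hk⟩ := ha h
        exact ⟨k, by rw [mul_assoc, hh, hk]⟩
      inv_mem' := by
        intro a ha
        -- finite: inverse is a power
        have hpow : ∀ n : ℕ, ∀ g, ∃ h, a ^ n * (g * y * g⁻¹) = h * y * h⁻¹ := by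
          intro n
          induction n with
          | zero => intro g; exact ⟨g, by simp⟩
          | succ n ih =>
            intro g
            obtain ⟨h, hh⟩ := ha g
            obtain ⟨k, hk⟩ := ih h
            exact ⟨k, by rw [pow_succ, mul_assoc, hh, hk]⟩
        have : a⁻¹ = a ^ (orderOf a - 1) := by
          rw [inv_eq_iff_mul_eq_one, ← pow_succ', Nat.sub_add_cancel (orderOf_pos a),
            pow_orderOf_eq_one]
        intro g
        rw [this]
        exact hpow _ g }
  have hDn : D.Normal := ⟨fun d hd k g => by
    obtain ⟨h, hh⟩ := hd (k⁻¹ * g)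
    refine ⟨k * h, ?_⟩
    calc k * d * k⁻¹ * (g * y * g⁻¹) = k * (d * (k⁻¹ * g * y * (k⁻¹ * g)⁻¹)) * k⁻¹ := by group
      _ = _ := by rw [hh]; group⟩
  have hxD : ∀ g, g * x⁻¹ * g⁻¹ * x ∈ D := by
    intro g t
    obtain ⟨k, hk, b, hb, rfl⟩ := hF1' t
    obtain ⟨h, hh, c, hc, hkc⟩ := hF2 (k⁻¹ * g)
    have e1 : k * b * y * (k * b)⁻¹ = k * y * k⁻¹ := by
      calc k * b * y * (k * b)⁻¹ = k * (b * y * b⁻¹) * k⁻¹ := by group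
        _ = _ := by rw [conj_eq hb]
    have hg : g = k * h * c := by rw [mul_assoc, ← hkc]; group
    have e2 : g * x⁻¹ * g⁻¹ = k * h * x⁻¹ * h⁻¹ * k⁻¹ := by
      calc g * x⁻¹ * g⁻¹ = k * h * (c * x * c⁻¹)⁻¹ * h⁻¹ * k⁻¹ := by rw [hg]; group
        _ = _ := by rw [conj_eq hc]
    refine ⟨k * h, ?_⟩
    rw [e1, e2]
    have e3 : x = k * x * k⁻¹ := (conj_eq hk).symm
    calc k * h * x⁻¹ * h⁻¹ * k⁻¹ * x * (k * y * k⁻¹)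
        = k * h * x⁻¹ * h⁻¹ * k⁻¹ * (k * x * k⁻¹) * (k * y * k⁻¹) := by rw [← e3]
      _ = k * h * x⁻¹ * h⁻¹ * (x * y) * k⁻¹ := by group
      _ = k * h * x⁻¹ * h⁻¹ * (h * (x * y) * h⁻¹) * k⁻¹ := by rw [conj_eq hh]
      _ = _ := by group
  obtain ⟨g₀, hg₀⟩ := Cz_lt_top_of_prime hp hx
  let L : Subgroup G := (Cz (QuotientGroup.mk' D y)).comap (QuotientGroup.mk' D)
  have hL : ∀ g, g ∈ L ↔ g * y * g⁻¹ * y⁻¹ ∈ D := by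
    intro g
    rw [mem_comap, mem_Cz, ← map_mul, ← map_mul, QuotientGroup.mk'_eq_mk']
    constructor
    · rintro ⟨z, hz, hzz⟩
      have : g * y * g⁻¹ * y⁻¹ = (g * y) * z⁻¹ * (g * y)⁻¹ := by
        calc g * y * g⁻¹ * y⁻¹ = (g * y) * (y * g)⁻¹ := by group
          _ = _ := by rw [← hzz]; group
      rw [this]; exact hDn.conj_mem _ (D.inv_mem hz) _
    · intro h
      refine ⟨(g * y)⁻¹ * (y * g), ?_, by group⟩
      have : (g * y)⁻¹ * (y * g) = (g * y)⁻¹ * (g * y * g⁻¹ * y⁻¹)⁻¹ * (g * y)⁻¹⁻¹ := by group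
      rw [this]; exact hDn.conj_mem _ (D.inv_mem h) _
  have hCL : Cz y ≤ L := by
    intro g hg
    rw [hL, conj_eq hg]; simp
  have hLtop : L = ⊤ := by
    have h1 := relIndex_mul_index hCL
    rw [hy] at h1
    have h2 : L.index ∣ q := Dvd.intro_left _ h1
    rcases (Nat.dvd_prime hq).1 h2 with h3 | h3
    · exact index_eq_one.1 h3
    · exfalso
      rw [h3] at h1
      have h4 : (Cz y).relIndex L = 1 := Nat.eq_of_mul_eq_mul_right hq.pos (by simpa using h1)
      rw [relIndex_eq_one] at h4
      have hd := hxD g₀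
      obtain ⟨h, hh⟩ := hd 1
      have hhL : h ∈ L := by
        rw [hL, ← hh]; simpa using hd
      rw [conj_eq (h4 hhL)] at hh
      simp at hh
      apply hg₀
      calc g₀ * x * g₀⁻¹ = (g₀ * x⁻¹ * g₀⁻¹)⁻¹ := by group
        _ = x := by rw [mul_eq_one_iff_eq_inv.1 hh, inv_inv]
  have hD : ∀ d, d ∈ D ↔ ∃ g, g * y * g⁻¹ = d * y := by
    intro d
    constructor
    · intro hd
      obtain ⟨h, hh⟩ := hd 1
      exact ⟨h, by rw [← hh]; simp⟩
    · rintro ⟨g, hg⟩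
      have : g ∈ L := hLtop ▸ mem_top g
      rw [hL, hg] at this
      simpa using this
  have hcard : Nat.card D = q := by
    have hc : ∀ d : D, ∃ g, g * y * g⁻¹ = d * y := fun d => (hD d).1 d.2
    choose f hf using hc
    rw [← hy]
    apply Nat.card_eq_of_bijective (fun d => (f d : G ⧸ Cz y))
    constructor
    · intro a b hab
      have hab' : (f a)⁻¹ * f b ∈ Cz y := QuotientGroup.eq.1 hab
      have e := conj_eq hab'
      have : f b * y * (f b)⁻¹ = f a * y * (f a)⁻¹ := by
        calc f b * y * (f b)⁻¹ = f a * ((f a)⁻¹ * f b * y * ((f a)⁻¹ * f b)⁻¹) * (f a)⁻¹ := by group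
          _ = _ := by rw [e]
      rw [hf, hf] at this
      exact (Subtype.ext (mul_right_cancel this)).symm
    · intro c
      induction c using QuotientGroup.induction_on with | H g => ?_
      have hg : g * y * g⁻¹ * y⁻¹ ∈ D := (hD _).2 ⟨g, by group⟩
      refine ⟨⟨_, hg⟩, ?_⟩
      apply QuotientGroup.eq.2
      apply mem_Cz'
      have := hf ⟨_, hg⟩
      set t := f ⟨_, hg⟩
      simp only [inv_mul_cancel_right] at this
      calc t⁻¹ * g * y * (t⁻¹ * g)⁻¹ = t⁻¹ * (g * y * g⁻¹) * t := by group
        _ = y := by rw [← this]; group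
  refine ⟨D, hDn, hcard, hD, ?_, ?_⟩
  · intro g
    have h1 := D.inv_mem (hxD g)
    have h2 := hDn.conj_mem _ h1 x
    have : g * x * g⁻¹ * x⁻¹ = x * (g * x⁻¹ * g⁻¹ * x)⁻¹ * x⁻¹ := by group
    rw [this]; exact h2
  · set d := g₀ * x⁻¹ * g₀⁻¹ * x with hd
    have hdD : d ∈ D := hxD g₀
    have hd1 : d ≠ 1 := by
      intro hh
      apply hg₀
      calc g₀ * x * g₀⁻¹ = (g₀ * x⁻¹ * g₀⁻¹)⁻¹ := by group
        _ = x := by rw [mul_eq_one_iff_eq_inv.1 hh, inv_inv]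
    have hod : orderOf d = q := by
      have h1 : orderOf d ∣ q := hcard ▸ Subgroup.orderOf_dvd_natCard D hdD
      rcases (Nat.dvd_prime hq).1 h1 with h | h
      · exact absurd (orderOf_eq_one_iff.1 h) hd1
      · exact h
    have hxc : x * d = d * x := by
      obtain ⟨g, hg⟩ := (hD d).1 hdD
      obtain ⟨a, ha, b, hb, rfl⟩ := hF1' g
      have e1 : d = a * y * a⁻¹ * y⁻¹ := by
        rw [eq_mul_inv_iff_mul_eq, ← hg]
        calc a * b * y * (a * b)⁻¹ = a * (b * y * b⁻¹) * a⁻¹ := by group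
          _ = _ := by rw [conj_eq hb]
      have cxy : Commute x y := hxy
      have cxa : Commute x a := (mem_Cz.1 ha).symm
      rw [e1]
      exact ((cxa.mul_right cxy).mul_right cxa.inv_right).mul_right cxy.inv_right
    rw [← hod]
    apply orderOf_dvd_of_pow_eq_one
    have e2 : g₀ * x⁻¹ * g₀⁻¹ = d * x⁻¹ := by rw [hd]; group
    have cdx : Commute d x⁻¹ := (show Commute x d from hxc).symm.inv_right
    have e3 := congrArg (· ^ orderOf x) e2
    simp only [conj_pow, cdx.mul_pow, inv_pow, pow_orderOf_eq_one] at e3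
    simpa using e3.symm

lemma lemC [Finite G] {y : G} {p q : ℕ} (hp : p.Prime) (hq : q.Prime) (hpq : p ≠ q)
    (hy : (Cz y).index = q) (D : Subgroup G) (hDn : D.Normal) (hcard : Nat.card D = p)
    (hyD : ∀ g, g * y * g⁻¹ * y⁻¹ ∈ D) : Cz y = Subgroup.centralizer (D : Set G) := by
  classical
  haveI : Fact p.Prime := ⟨hp⟩
  haveI : IsCyclic D := isCyclic_of_prime_card hcard
  letI : CommGroup D := { (inferInstance : Group D) with
    mul_comm := fun a b => IsCyclic.isMulCommutative.is_comm.comm a b }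
  letI : Fintype (G ⧸ Cz y) := Fintype.ofFinite _
  let e₀ : G → D := fun g => ⟨g * y * g⁻¹ * y⁻¹, hyD g⟩
  let e : G ⧸ Cz y → D := Quotient.lift e₀ (by
    intro a b hab
    have hab' : a⁻¹ * b ∈ Cz y := QuotientGroup.leftRel_apply.1 hab
    apply Subtype.ext
    have := conj_eq hab'
    show a * y * a⁻¹ * y⁻¹ = b * y * b⁻¹ * y⁻¹
    calc a * y * a⁻¹ * y⁻¹ = a * (a⁻¹ * b * y * (a⁻¹ * b)⁻¹) * a⁻¹ * y⁻¹ := by rw [this]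
      _ = _ := by group)
  have he : ∀ (g : G) (c : G ⧸ Cz y), e (g • c) = MulAut.conjNormal g (e c) * e₀ g := by
    intro g c
    induction c using QuotientGroup.induction_on with | H h => ?_
    apply Subtype.ext
    show g * h * y * (g * h)⁻¹ * y⁻¹ = g * (h * y * h⁻¹ * y⁻¹) * g⁻¹ * (g * y * g⁻¹ * y⁻¹)
    group
  let d : D := ∏ c, e c
  have hd : ∀ g : G, d = MulAut.conjNormal g d * (e₀ g) ^ q := by
    intro g
    calc d = ∏ c, e (g • c) := (Equiv.prod_comp (MulAction.toPerm g) e).symm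
      _ = _ := by
        simp only [he, Finset.prod_mul_distrib, Finset.prod_const, d, map_prod]
        congr 2
        rw [← hy, Finset.card_univ, ← Nat.card_eq_fintype_card]; rfl
  have key : ∀ g : G, g ∈ Cz y ↔ g ∈ Cz (d : G) := by
    intro g
    have h1 := hd g
    constructor
    · intro hg
      have : e₀ g = 1 := Subtype.ext (by show g * y * g⁻¹ * y⁻¹ = 1; rw [conj_eq hg]; simp)
      rw [this, one_pow, mul_one] at h1
      apply mem_Cz'
      have := congrArg Subtype.val h1
      rw [MulAut.conjNormal_apply] at this
      exact this.symm
    · intro hg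
      have h2 : MulAut.conjNormal g d = d := Subtype.ext (by
        rw [MulAut.conjNormal_apply]; exact conj_eq hg)
      rw [h2] at h1
      have h3 : (e₀ g) ^ q = 1 := by
        simpa using h1.symm
      have h4 : (e₀ g) ^ p = 1 := by rw [← hcard]; exact pow_card_eq_one'
      have h5 : e₀ g = 1 := by
        have h6 : orderOf (e₀ g) ∣ Nat.gcd p q :=
          Nat.dvd_gcd (orderOf_dvd_of_pow_eq_one h4) (orderOf_dvd_of_pow_eq_one h3)
        rw [(Nat.coprime_primes hp hq).2 hpq, Nat.dvd_one, orderOf_eq_one_iff] at h6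
        exact h6
      have h7 : g * y * g⁻¹ * y⁻¹ = 1 := congrArg Subtype.val h5
      exact mem_Cz' (mul_inv_eq_one.1 h7)
  obtain ⟨g₀, hg₀⟩ := Cz_lt_top_of_prime hq hy
  have hd1 : d ≠ 1 := by
    intro h
    apply hg₀
    apply conj_eq
    rw [key, h, mem_Cz]; simp
  have hz : zpowers d = ⊤ := zpowers_eq_top_of_prime_card hcard hd1
  ext g
  rw [key, mem_centralizer_iff]
  constructor
  · intro hg t ht
    have : (⟨t, ht⟩ : D) ∈ zpowers d := hz ▸ mem_top _
    obtain ⟨k, hk⟩ := mem_zpowers_iff.1 this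
    have hk' : (d : G) ^ k = t := by
      have := congrArg Subtype.val hk
      simpa using this
    rw [← hk']
    have hc : Commute (d : G) g := (mem_Cz.1 hg).symm
    exact hc.zpow_left k
  · intro h
    exact mem_Cz.2 (h d d.2).symm

lemma Cz_pow_le (x : G) (k : ℕ) : Cz x ≤ Cz (x ^ k) := by
  intro g hg
  have hc : Commute g x := mem_Cz.1 hg
  exact mem_Cz.2 (hc.pow_right k)

lemma lemP [Finite G] {p : ℕ} (hp : p.Prime) : ∀ (N : ℕ) (x : G), orderOf x ≤ N →
    (Cz x).index = p → ∃ x : G, (Cz x).index = p ∧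
      ∀ a b : ℕ, a.Prime → b.Prime → a ∣ orderOf x → b ∣ orderOf x → a = b := by
  intro N
  induction N with
  | zero => intro x hx; have := orderOf_pos x; omega
  | succ N ih =>
    intro x hxN hx
    by_cases hgood : ∀ a b : ℕ, a.Prime → b.Prime → a ∣ orderOf x → b ∣ orderOf x → a = b
    · exact ⟨x, hx, hgood⟩
    push Not at hgood
    obtain ⟨a, b, ha, hb, hax, hbx, hab⟩ := hgood
    have h0 : orderOf x ≠ 0 := (orderOf_pos x).ne'
    obtain ⟨k, t, hat, hkt⟩ := Nat.exists_eq_pow_mul_and_not_dvd h0 a ha.ne_one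
    have hk : k ≠ 0 := by
      rintro rfl
      rw [pow_zero, one_mul] at hkt
      exact hat (hkt ▸ hax)
    have hbt : b ∣ t := by
      rw [hkt] at hbx
      rcases hb.dvd_mul.1 hbx with h | h
      · exact absurd ((Nat.prime_dvd_prime_iff_eq hb ha).1 (hb.dvd_of_dvd_pow h)) (Ne.symm hab)
      · exact h
    have ht1 : 1 < t := by
      have : t ≠ 0 := by rintro rfl; simp at hat
      exact lt_of_lt_of_le hb.one_lt (Nat.le_of_dvd (Nat.pos_of_ne_zero this) hbt)
    have hak : 1 < a ^ k := Nat.one_lt_pow hk ha.one_lt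
    have o1 : orderOf (x ^ (a ^ k)) = t := by
      rw [orderOf_pow, hkt, Nat.gcd_eq_right (Dvd.intro _ rfl), Nat.mul_div_cancel_left _ (by omega)]
    have o2 : orderOf (x ^ t) = a ^ k := by
      rw [orderOf_pow, hkt, Nat.gcd_eq_right (Dvd.intro_left _ rfl), Nat.mul_div_cancel _ (by omega)]
    have d1 : (Cz (x ^ (a ^ k))).index ∣ p := hx ▸ index_dvd_of_le (Cz_pow_le x _)
    have d2 : (Cz (x ^ t)).index ∣ p := hx ▸ index_dvd_of_le (Cz_pow_le x _)
    rcases (Nat.dvd_prime hp).1 d1 with h1 | h1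
    · rcases (Nat.dvd_prime hp).1 d2 with h2 | h2
      · exfalso
        obtain ⟨g, hg⟩ := Cz_lt_top_of_prime hp hx
        apply hg
        have m1 : Commute g (x ^ (a ^ k)) := mem_Cz.1 ((index_eq_one.1 h1) ▸ mem_top g)
        have m2 : Commute g (x ^ t) := mem_Cz.1 ((index_eq_one.1 h2) ▸ mem_top g)
        have hcop : Nat.Coprime (a ^ k) t := Nat.Coprime.pow_left _ ((Nat.Prime.coprime_iff_not_dvd ha).2 hat)
        have hbez : (1 : ℤ) = (a ^ k : ℕ) * Nat.gcdA (a ^ k) t + t * Nat.gcdB (a ^ k) t := by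
          rw [← Nat.gcd_eq_gcd_ab, hcop]; rfl
        have hx1 : x = (x ^ (a ^ k)) ^ (Nat.gcdA (a ^ k) t) * (x ^ t) ^ (Nat.gcdB (a ^ k) t) := by
          rw [← zpow_natCast x (a ^ k), ← zpow_natCast x t, ← zpow_mul, ← zpow_mul, ← zpow_add, ← hbez, zpow_one]
        have : Commute g x := by
          rw [hx1]; exact (m1.zpow_right _).mul_right (m2.zpow_right _)
        exact conj_eq (mem_Cz.2 this)
      · apply ih (x ^ t) _ h2
        rw [o2]; nlinarith
    · apply ih (x ^ (a ^ k)) _ h1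
      rw [o1]; nlinarith

lemma Cz_mul_le_left {x y : G} (hxy : x * y = y * x) (hc : Nat.Coprime (orderOf x) (orderOf y)) :
    Cz (x * y) ≤ Cz x := by
  intro g hg
  have c : Commute x y := hxy
  have h1 : (x * y) ^ orderOf y = x ^ orderOf y := by
    rw [c.mul_pow, pow_orderOf_eq_one, mul_one]
  obtain ⟨k, hk⟩ := exists_pow_eq_self_of_coprime (x := x) hc.symm
  have := Cz_pow_le _ k (Cz_pow_le _ (orderOf y) hg)
  rwa [h1, hk] at this

/-- pair lemma -/
lemma pair [Finite G] {x y : G} {p q : ℕ} (hp : p.Prime) (hq : q.Prime) (hpq : p ≠ q)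
    (hx : (Cz x).index = p) (hy : (Cz y).index = q)
    (ux : ∀ a b : ℕ, a.Prime → b.Prime → a ∣ orderOf x → b ∣ orderOf x → a = b)
    (uy : ∀ a b : ℕ, a.Prime → b.Prime → a ∣ orderOf y → b ∣ orderOf y → a = b)
    (hno : ∀ g : G, (Cz g).index ≠ p * q) :
    q ∣ orderOf x ∨ (p ∣ orderOf x ∧ ∃ D : Subgroup G, D.Normal ∧ Nat.card D = p ∧
      (∀ d, d ∈ D ↔ ∃ g, g * x * g⁻¹ = d * x) ∧ (∀ g, g * y * g⁻¹ * y⁻¹ ∈ D)) := by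
  by_cases hxy : x * y = y * x
  swap
  · exact Or.inl (lemA hp hq hpq hx hy hxy)
  have hi : (Cz x ⊓ Cz y).index = p * q := by
    rw [index_inf_of_coprime, hx, hy]
    rw [hx, hy]; exact (Nat.coprime_primes hp hq).2 hpq
  have hle : Cz x ⊓ Cz y ≤ Cz (x * y) := by
    intro g hg
    have c1 : Commute g x := mem_Cz.1 hg.1
    have c2 : Commute g y := mem_Cz.1 hg.2
    exact mem_Cz.2 (c1.mul_right c2)
  have hncop : ¬ Nat.Coprime (orderOf x) (orderOf y) := by
    intro hc
    apply hno (x * y)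
    rw [← hi]
    congr 1
    apply le_antisymm _ hle
    refine le_inf (Cz_mul_le_left hxy hc) ?_
    have := Cz_mul_le_left hxy.symm hc.symm
    rwa [← hxy] at this
  have hdvd : (Cz (x * y)).index ∣ p * q := hi ▸ index_dvd_of_le hle
  have h3 : (Cz (x * y)).index = q ∨ (Cz (x * y)).index = p := by
    have hall : (Cz (x * y)).index = 1 → False := by
      intro h1
      have hxx : Cz x = Cz y := by
        ext g
        have c : Commute g (x * y) := mem_Cz.1 ((index_eq_one.1 h1) ▸ mem_top g)
        constructor
        · intro h
          have c1 : Commute g x := mem_Cz.1 h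
          have := c1.inv_right.mul_right c
          rw [inv_mul_cancel_left] at this
          exact mem_Cz.2 this
        · intro h
          have c1 : Commute g y := mem_Cz.1 h
          have := c.mul_right c1.inv_right
          rw [mul_inv_cancel_right] at this
          exact mem_Cz.2 this
      rw [hxx, hy] at hx
      exact hpq hx.symm
    obtain ⟨a, b, ha, hb, hab⟩ := (Nat.dvd_mul).1 hdvd
    rcases (Nat.dvd_prime hp).1 ha with rfl | rfl <;> rcases (Nat.dvd_prime hq).1 hb with rfl | rfl
    · exact (hall (by simpa using hab.symm)).elim
    · left; simpa using hab.symm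
    · right; simpa using hab.symm
    · exact (hno _ hab.symm).elim
  rcases h3 with h3 | h3
  · left
    obtain ⟨D, -, -, -, -, h⟩ := lemB hp hq hpq hx hy hxy h3
    exact h
  · right
    rw [hxy] at h3
    obtain ⟨D, h1, h2, h4, h5, h6⟩ := lemB hq hp hpq.symm hy hx hxy.symm h3
    refine ⟨?_, D, h1, h2, h4, h5⟩
    obtain ⟨a, ha, hax, hay⟩ := Nat.Prime.not_coprime_iff_dvd.1 hncop
    rwa [← uy a p ha hp hay h6]

lemma main [Finite G] {p q r : ℕ} (hp : p.Prime) (hq : q.Prime) (hr : r.Prime)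
    (hpq : p ≠ q) (hpr : p ≠ r) (hqr : q ≠ r)
    (h1 : ∃ x : G, (Cz x).index = p) (h2 : ∃ x : G, (Cz x).index = q)
    (h3 : ∃ x : G, (Cz x).index = r) :
    (∃ g : G, (Cz g).index = p * q) ∨ (∃ g : G, (Cz g).index = p * r) := by
  by_contra! hno
  obtain ⟨x, hx⟩ := h1
  obtain ⟨y, hy⟩ := h2
  obtain ⟨z, hz⟩ := h3
  obtain ⟨x, hx, ux⟩ := lemP hp _ x le_rfl hx
  obtain ⟨y, hy, uy⟩ := lemP hq _ y le_rfl hy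
  obtain ⟨z, hz, uz⟩ := lemP hr _ z le_rfl hz
  rcases pair hp hq hpq hx hy ux uy hno.1 with h | ⟨h, D, n1, c1, m1, y1⟩ <;>
  rcases pair hp hr hpr hx hz ux uz hno.2 with h' | ⟨h', E, n2, c2, m2, z2⟩
  · exact hqr (ux q r hq hr h h')
  · exact hpq (ux p q hp hq h' h)
  · exact hpr (ux p r hp hr h h')
  · have hDE : D = E := by
      ext d; rw [m1, m2]
    subst hDE
    have e1 := lemC hp hq hpq hy D n1 c1 y1
    have e2 := lemC hp hr hpr hz D n1 c1 z2
    rw [e1, ← e2, hz] at hy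
    exact hqr hy.symm

end CsAux

/-- If `cs(G) = {1, p₁, p₂, p₃, m, n}` with `p₁, p₂, p₃` distinct primes and `m, n` the unique
composite members of `cs(G)`, then after a relabelling `(i, j, k)` of `(1, 2, 3)` we have
`m = pᵢ * pⱼ` and `n = pᵢ * p_k`. -/
theorem stmt_1 (G : Type*) [Group G] [Finite G] (p₁ p₂ p₃ m n : ℕ)
    (hp₁ : p₁.Prime) (hp₂ : p₂.Prime) (hp₃ : p₃.Prime)
    (h12 : p₁ ≠ p₂) (h13 : p₁ ≠ p₃) (h23 : p₂ ≠ p₃)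
    (hm : IsCompositeNat m) (hn : IsCompositeNat n) (hmn : m ≠ n)
    (hcs : csSet G = {1, p₁, p₂, p₃, m, n})
    (huniq : ∀ x ∈ csSet G, IsCompositeNat x → x = m ∨ x = n) :
    ∃ σ : Equiv.Perm (Fin 3),
      m = ![p₁, p₂, p₃] (σ 0) * ![p₁, p₂, p₃] (σ 1) ∧
      n = ![p₁, p₂, p₃] (σ 0) * ![p₁, p₂, p₃] (σ 2) := by
  have e : ∀ k ∈ csSet G, ∃ x : G, (CsAux.Cz x).index = k := by
    rintro k ⟨g, hg⟩; exact ⟨g, hg.symm⟩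
  have e1 := e p₁ (by rw [hcs]; simp)
  have e2 := e p₂ (by rw [hcs]; simp)
  have e3 := e p₃ (by rw [hcs]; simp)
  have key : ∀ a b : ℕ, a.Prime → b.Prime → (∃ g : G, (CsAux.Cz g).index = a * b) →
      a * b = m ∨ a * b = n := by
    rintro a b ha hb ⟨g, hg⟩
    refine huniq _ ⟨g, hg.symm⟩ ⟨?_, Nat.not_prime_mul ha.ne_one hb.ne_one⟩
    nlinarith [ha.two_le, hb.two_le]
  have H1 := (CsAux.main hp₁ hp₂ hp₃ h12 h13 h23 e1 e2 e3).imp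
    (key _ _ hp₁ hp₂) (key _ _ hp₁ hp₃)
  have H2 := (CsAux.main hp₂ hp₁ hp₃ h12.symm h23 h13 e2 e1 e3).imp
    (key _ _ hp₂ hp₁) (key _ _ hp₂ hp₃)
  have H3 := (CsAux.main hp₃ hp₁ hp₂ h13.symm h23.symm h12 e3 e1 e2).imp
    (key _ _ hp₃ hp₁) (key _ _ hp₃ hp₂)
  rw [mul_comm p₂ p₁] at H2
  rw [mul_comm p₃ p₁, mul_comm p₃ p₂] at H3
  have n1 : p₁ * p₂ ≠ p₁ * p₃ := fun h => h23 (Nat.eq_of_mul_eq_mul_left hp₁.pos h)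
  have n2 : p₁ * p₂ ≠ p₂ * p₃ := fun h => h13 (Nat.eq_of_mul_eq_mul_left hp₂.pos (by linarith))
  have n3 : p₁ * p₃ ≠ p₂ * p₃ := fun h => h12 (Nat.eq_of_mul_eq_mul_right hp₃.pos h)
  have hcases : (m = p₁ * p₂ ∧ n = p₁ * p₃) ∨ (m = p₁ * p₃ ∧ n = p₁ * p₂) ∨
      (m = p₂ * p₁ ∧ n = p₂ * p₃) ∨ (m = p₂ * p₃ ∧ n = p₂ * p₁) ∨
      (m = p₃ * p₁ ∧ n = p₃ * p₂) ∨ (m = p₃ * p₂ ∧ n = p₃ * p₁) := by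
    rw [mul_comm p₂ p₁, mul_comm p₃ p₁, mul_comm p₃ p₂]
    generalize p₁ * p₂ = A at *
    generalize p₁ * p₃ = B at *
    generalize p₂ * p₃ = C at *
    clear hcs huniq key e
    rcases H1 with (h | h) | (h | h) <;> rcases H2 with (h' | h') | (h' | h') <;>
      rcases H3 with (h'' | h'') | (h'' | h'') <;> clear e1 e2 e3 <;> subst_vars <;> simp_all
  have s0 : ∀ a b c : Fin 3, a ≠ b → a ≠ c → b ≠ c →
      ∃ σ : Equiv.Perm (Fin 3), σ 0 = a ∧ σ 1 = b ∧ σ 2 = c := by decide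
  have fin : ∀ a b c : Fin 3, a ≠ b → a ≠ c → b ≠ c →
      m = ![p₁, p₂, p₃] a * ![p₁, p₂, p₃] b → n = ![p₁, p₂, p₃] a * ![p₁, p₂, p₃] c →
      ∃ σ : Equiv.Perm (Fin 3),
      m = ![p₁, p₂, p₃] (σ 0) * ![p₁, p₂, p₃] (σ 1) ∧
      n = ![p₁, p₂, p₃] (σ 0) * ![p₁, p₂, p₃] (σ 2) := by
    intro a b c hab hac hbc h h'
    obtain ⟨σ, rfl, rfl, rfl⟩ := s0 a b c hab hac hbc
    exact ⟨σ, h, h'⟩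
  rcases hcases with ⟨h, h'⟩ | ⟨h, h'⟩ | ⟨h, h'⟩ | ⟨h, h'⟩ | ⟨h, h'⟩ | ⟨h, h'⟩
  · exact fin 0 1 2 (by decide) (by decide) (by decide) h h'
  · exact fin 0 2 1 (by decide) (by decide) (by decide) h h'
  · exact fin 1 0 2 (by decide) (by decide) (by decide) h h'
  · exact fin 1 2 0 (by decide) (by decide) (by decide) h h'
  · exact fin 2 0 1 (by decide) (by decide) (by decide) h h'
  · exact fin 2 1 0 (by decide) (by decide) (by decide) h h'
end

section
/- Let G be a finite group with cs(G) = {1, p_1, p_2, p_3, m, n}, where p_1, p_2, p_3 are distinct primes and m, n are the unique composite numbers in cs(G), relabelled so that m = p_1·p_2 and n = p_1·p_3. Then G is an internal direct product G = A × P × H, where A is abelian, P is a p_1-group of nilpotency class at most 2 with cs(P) = {1, p_1}, and H satisfies cs(H) = {1, p_2, p_3} with H/Z(H) a nonabelian group of order p_2·p_3 (i.e. H/Z(H) is a Frobenius group of order p_2·p_3). -/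
set_option linter.unusedSectionVars false

namespace Stmt2Aux
open Subgroup

abbrev C {G : Type*} [Group G] (g : G) : Subgroup G := Subgroup.centralizer {g}

theorem mem_C {G : Type*} [Group G] {g h : G} : h ∈ C g ↔ h * g = g * h :=
  Subgroup.mem_centralizer_singleton_iff

theorem mem_C' {G : Type*} [Group G] {g h : G} : h ∈ C g ↔ h * g * h⁻¹ = g := by
  rw [mem_C, mul_inv_eq_iff_eq_mul]

theorem C_symm {G : Type*} [Group G] {g h : G} : h ∈ C g ↔ g ∈ C h := by
  rw [mem_C, mem_C, eq_comm]

theorem sz_conj {G : Type*} [Group G] (g k : G) : (C (k * g * k⁻¹)).index = (C g).index := by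
  have : C g = (C (k * g * k⁻¹)).comap (MulAut.conj k).toMonoidHom := by
    ext h
    simp only [mem_comap, mem_C]
    simp only [MulEquiv.coe_toMonoidHom, MulAut.conj_apply]
    constructor
    · intro e
      calc k * h * k⁻¹ * (k * g * k⁻¹) = k * (h * g) * k⁻¹ := by group
        _ = _ := by rw [e]; group
    · intro e
      have : k * (h * g) * k⁻¹ = k * (g * h) * k⁻¹ := by
        calc _ = k * h * k⁻¹ * (k * g * k⁻¹) := by group
          _ = _ := by rw [e]; group
      simpa using this
  rw [this, index_comap_of_surjective]
  exact (MulAut.conj k).surjective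

section
variable {G : Type*} [Group G] [Finite G]

theorem index_inf_coprime {A B : Subgroup G} (h : A.index.Coprime B.index) :
    (A ⊓ B).index = A.index * B.index := by
  apply le_antisymm index_inf_le
  apply Nat.le_of_dvd (Nat.pos_of_ne_zero FiniteIndex.index_ne_zero)
  exact h.mul_dvd_of_dvd_of_dvd (index_dvd_of_le inf_le_left) (index_dvd_of_le inf_le_right)

theorem pair_trans {A B : Subgroup G} (h : A.index.Coprime B.index) (g k : G) :
    ∃ l, g⁻¹ * l ∈ A ∧ k⁻¹ * l ∈ B := by
  let f : G ⧸ (A ⊓ B) → (G ⧸ A) × (G ⧸ B) :=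
    fun c => (Subgroup.quotientMapOfLE inf_le_left c, Subgroup.quotientMapOfLE inf_le_right c)
  have hf : Function.Injective f := by
    intro a b
    induction a using QuotientGroup.induction_on
    induction b using QuotientGroup.induction_on
    simp only [f, Subgroup.quotientMapOfLE_apply_mk, Prod.mk.injEq, QuotientGroup.eq]
    exact fun h => ⟨h.1, h.2⟩
  have := (hf.bijective_of_nat_card_le (by
    rw [Nat.card_prod]; exact (index_inf_coprime h).ge)).2 ((g : G ⧸ A), (k : G ⧸ B))
  obtain ⟨c, hc⟩ := this
  induction c using QuotientGroup.induction_on with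
  | H l =>
  refine ⟨l, ?_⟩
  simp only [f, Subgroup.quotientMapOfLE_apply_mk, Prod.mk.injEq] at hc
  exact ⟨QuotientGroup.eq.1 hc.1.symm, QuotientGroup.eq.1 hc.2.symm⟩

theorem exists_primary {D K : Subgroup G} (h : ¬ D ≤ K) :
    ∃ u k : ℕ, u.Prime ∧ ∃ w ∈ D, w ∉ K ∧ orderOf w = u ^ k := by
  have h1 : (K.subgroupOf D).index ≠ 1 := by
    rw [Ne, index_eq_one, subgroupOf_eq_top]; exact h
  obtain ⟨u, hu, hd⟩ := Nat.exists_prime_and_dvd h1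
  have : Fact u.Prime := ⟨hu⟩
  obtain ⟨S⟩ : Nonempty (Sylow u D) := inferInstance
  have : ¬ (S : Subgroup D) ≤ K.subgroupOf D := fun hle =>
    S.not_dvd_index (hd.trans (index_dvd_of_le hle))
  obtain ⟨w, hw, hwK⟩ := SetLike.not_le_iff_exists.1 this
  obtain ⟨k, hk⟩ := IsPGroup.iff_orderOf.1 S.2 ⟨w, hw⟩
  refine ⟨u, k, hu, w, w.2, hwK, ?_⟩
  rw [← hk, Subgroup.orderOf_mk, Subgroup.orderOf_coe]

theorem conj_sub {l : ℕ} (hl : l.Prime) {Q H : Subgroup G} (hQ : IsPGroup l Q)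
    (h : ¬ l ∣ H.index) : ∃ g : G, ∀ w ∈ Q, g⁻¹ * w * g ∈ H := by
  have : Fact l.Prime := ⟨hl⟩
  obtain ⟨c, hc⟩ := hQ.nonempty_fixed_point_of_prime_not_dvd_card (G ⧸ H) h
  induction c using QuotientGroup.induction_on with
  | H g =>
  refine ⟨g, fun w hw => ?_⟩
  have := hc ⟨w⁻¹, inv_mem hw⟩
  change ((w⁻¹ * g : G) : G ⧸ H) = g at this
  have := QuotientGroup.eq.1 this
  simpa [mul_assoc] using this

theorem zp {l k : ℕ} {w : G} (hw : orderOf w = l ^ k) : IsPGroup l (zpowers w) :=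
  IsPGroup.of_card (n := k) (by rw [Nat.card_zpowers, hw])

theorem conj_elt {l k : ℕ} (hl : l.Prime) {w : G} (hw : orderOf w = l ^ k) {H : Subgroup G}
    (h : ¬ l ∣ H.index) : ∃ g : G, g * w * g⁻¹ ∈ H := by
  obtain ⟨g, hg⟩ := conj_sub hl (zp hw) h
  exact ⟨g⁻¹, by simpa using hg w (mem_zpowers w)⟩

theorem C_mul_le {a b : G} (hc : a * b = b * a) (ho : (orderOf a).Coprime (orderOf b)) :
    C (a * b) ≤ C a := by
  have hcc : Commute a b := hc
  obtain ⟨k, hk⟩ : ∃ k : ℕ, (a * b) ^ k = a := by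
    obtain ⟨k, h1, h2⟩ := Nat.chineseRemainder ho 1 0
    refine ⟨k, ?_⟩
    rw [hcc.mul_pow, pow_eq_pow_iff_modEq.2 h1, pow_eq_pow_iff_modEq.2 h2]; simp
  intro g hg
  rw [mem_C] at *
  have h1 : Commute g (a * b) := hg
  have h2 := h1.pow_right k
  rw [hk] at h2
  exact h2

theorem C_mul_eq {a b : G} (hc : a * b = b * a) (ho : (orderOf a).Coprime (orderOf b)) :
    C (a * b) = C a ⊓ C b := by
  apply le_antisymm
  · apply le_inf (C_mul_le hc ho)
    rw [hc]; exact C_mul_le hc.symm ho.symm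
  · rintro g ⟨h1, h2⟩
    have h1 : Commute g a := mem_C.1 h1
    have h2 : Commute g b := mem_C.1 h2
    exact mem_C.2 (h1.mul_right h2)

theorem ncard_class (x : G) : (Set.range fun g => g * x * g⁻¹).ncard = (C x).index := by
  have : (C x).index = (MulAction.orbit (ConjAct G) x).ncard := by
    rw [← MulAction.index_stabilizer, ConjAct.stabilizer_eq_centralizer]; rfl
  rw [this]; rfl

/-- stabilizer of a set under right multiplication -/
def rstab (X : Set G) : Subgroup G where
  carrier := {g | ∀ c, c * g ∈ X ↔ c ∈ X}
  one_mem' := by simp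
  mul_mem' := by
    intro a b ha hb c
    rw [← mul_assoc, hb, ha]
  inv_mem' := by
    intro a ha c
    have := ha (c * a⁻¹)
    simpa using this.symm

theorem rstab_dvd (X : Set G) : Nat.card (rstab X) ∣ X.ncard := by
  have : ((↑) : G → G ⧸ rstab X) ⁻¹' ((↑) '' X) = X := by
    ext g
    constructor
    · rintro ⟨c, hc, h⟩
      have := QuotientGroup.eq.1 h
      have := this c
      rw [mul_inv_cancel_left] at this
      exact this.2 hc
    · exact fun h => ⟨g, h, rfl⟩
  have e := QuotientGroup.preimageMkEquivSubgroupProdSet (rstab X) ((↑) '' X)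
  rw [this] at e
  rw [← Nat.card_coe_set_eq, Nat.card_congr e, Nat.card_prod]
  exact dvd_mul_right _ _

theorem prime_fix {q : ℕ} (hq : q.Prime) {N : Subgroup G} (hN : Nat.card N = q) {y z : G}
    (hy : y ∈ N) (hy1 : y ≠ 1) (hz : z ∈ N) : z ∈ zpowers y := by
  have : Fact (Nat.card N).Prime := ⟨hN ▸ hq⟩
  have h := mem_zpowers_of_prime_card (G := N) (p := Nat.card N) rfl (g := ⟨y, hy⟩) (g' := ⟨z, hz⟩)
    (by simpa [Subtype.ext_iff] using hy1)
  obtain ⟨k, hk⟩ := h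
  exact ⟨k, by simpa [Subtype.ext_iff] using hk⟩

theorem prime_cent {q k : ℕ} (hq : q.Prime) {N : Subgroup G} [N.Normal] (hN : Nat.card N = q) {a : G}
    (ha : orderOf a = q ^ k) {y : G} (hy : y ∈ N) : a * y = y * a := by
  have : Fact q.Prime := ⟨hq⟩
  let f : zpowers a →* MulAut N := (MulAut.conjNormal).comp (zpowers a).subtype
  let _ : MulAction (zpowers a) N := MulAction.compHom N f
  obtain ⟨b, hb, hb1⟩ := (zp ha).exists_fixed_point_of_prime_dvd_card_of_fixed_point N (by rw [hN])
    (a := 1) (fun g => map_one (f g))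
  have hb2 := hb ⟨a, mem_zpowers a⟩
  have hb3 : a * b * a⁻¹ = b := congrArg Subtype.val hb2
  have hc : Commute a (b : G) := mul_inv_eq_iff_eq_mul.1 hb3
  obtain ⟨j, hj⟩ := prime_fix hq hN b.2 (by
    intro h; exact hb1 (Subtype.ext h.symm)) hy
  rw [← hj]
  exact hc.zpow_right j

theorem caseB {q r s i j : ℕ} (hq : q.Prime) (hr : r.Prime) (hs : s.Prime) (hlt : r < q)
    (hno : ∀ g : G, ¬ q * r ∣ (C g).index) {x y : G} (hx : (C x).index = q) (hy : (C y).index = r)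
    (ox : orderOf x = s ^ i) (oy : orderOf y = s ^ j) (_hxy : x * y = y * x) : False := by
  have hcop : (C x).index.Coprime (C y).index := by
    rw [hx, hy]; exact (Nat.coprime_primes hq hr).2 hlt.ne'
  set X : Set G := Set.range fun g => g * x * g⁻¹ with hX
  set Z : Set G := Set.range fun g => g * (x * y) * g⁻¹ with hZ
  have hXc : X.ncard = q := by rw [hX, ncard_class, hx]
  have hZX : ∀ k : G, (fun c => c * (k * y * k⁻¹)) '' X ⊆ Z := by
    rintro k _ ⟨_, ⟨g, rfl⟩, rfl⟩
    obtain ⟨l, h1, h2⟩ := pair_trans hcop g k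
    refine ⟨l, ?_⟩
    rw [mem_C] at h1 h2
    have e1 : l * x * l⁻¹ = g * x * g⁻¹ := by
      calc l * x * l⁻¹ = g * (g⁻¹ * l * x) * l⁻¹ := by group
        _ = _ := by rw [h1]; group
    have e2 : l * y * l⁻¹ = k * y * k⁻¹ := by
      calc l * y * l⁻¹ = k * (k⁻¹ * l * y) * l⁻¹ := by group
        _ = _ := by rw [h2]; group
    dsimp only
    rw [← e1, ← e2]; group
  have hic : ∀ k : G, ((fun c => c * (k * y * k⁻¹)) '' X).ncard = q := by
    intro k
    rw [Set.ncard_image_of_injective _ (mul_left_injective _), hXc]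
  have hZc : Z.ncard = q := by
    have h1 : q ≤ Z.ncard := by
      rw [← hic 1]; exact Set.ncard_le_ncard (hZX 1)
    have h2 : Z.ncard ∣ q * r := by
      rw [hZ, ncard_class, ← hx, ← hy, ← index_inf_coprime hcop]
      apply index_dvd_of_le
      rintro g ⟨h1, h2⟩
      have h1 : Commute g x := mem_C.1 h1
      have h2 : Commute g y := mem_C.1 h2
      exact mem_C.2 (h1.mul_right h2)
    have h3 : Z.ncard ≠ q * r := by
      intro h
      rw [hZ, ncard_class] at h
      exact hno _ h.symm.dvd
    obtain ⟨d1, d2, h4, h5, h6⟩ := (Nat.dvd_mul).1 h2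
    rcases (Nat.dvd_prime hq).1 h4 with e | e <;> rcases (Nat.dvd_prime hr).1 h5 with f | f <;>
      subst e <;> subst f
    · rw [← h6] at h1; have := hq.two_le; omega
    · rw [← h6] at h1; omega
    · rw [← h6]; simp
    · exact absurd h6.symm h3
  have hZe : ∀ k : G, (fun c => c * (k * y * k⁻¹)) '' X = Z := fun k =>
    Set.eq_of_subset_of_ncard_le (hZX k) (by rw [hic, hZc])
  set N := rstab X with hN
  have hyN : ∀ k : G, k * y * k⁻¹ * y⁻¹ ∈ N := by
    intro k c
    have h1 : c * (k * y * k⁻¹) ∈ Z ↔ c ∈ X := by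
      rw [← hZe k]; exact (mul_left_injective _).mem_set_image (s := X) (a := c)
    rw [← h1, ← hZe 1]
    have := (mul_left_injective (1 * y * 1⁻¹)).mem_set_image (s := X)
      (a := c * (k * y * k⁻¹ * y⁻¹))
    rw [← this]
    simp [mul_assoc]
  have hXconj : ∀ k c : G, k⁻¹ * c * k ∈ X ↔ c ∈ X := by
    intro k c
    constructor
    · rintro ⟨g, hg⟩
      exact ⟨k * g, by dsimp only at hg ⊢; rw [show c = k * (k⁻¹ * c * k) * k⁻¹ by group, ← hg]; group⟩
    · rintro ⟨g, rfl⟩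
      exact ⟨k⁻¹ * g, by dsimp only; group⟩
  have hNn : N.Normal := by
    constructor
    intro n hn k c
    rw [← hXconj k, ← hXconj k c, ← hn (k⁻¹ * c * k)]
    rw [show k⁻¹ * (c * (k * n * k⁻¹)) * k = k⁻¹ * c * k * n by group]
  have hney : ∃ k : G, k * y * k⁻¹ * y⁻¹ ≠ 1 := by
    by_contra! h
    have : C y = ⊤ := by
      rw [eq_top_iff]; intro k _
      rw [mem_C']; exact mul_inv_eq_one.1 (h k)
    rw [this, index_top] at hy
    exact hr.ne_one hy.symm
  have hNc : Nat.card N = q := by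
    rcases (Nat.dvd_prime hq).1 (hXc ▸ rstab_dvd X : Nat.card N ∣ q) with h | h
    · rw [Subgroup.card_eq_one] at h
      obtain ⟨k, hk⟩ := hney
      have := hyN k
      rw [h, mem_bot] at this
      exact absurd this hk
    · exact h
  have hxX : x ∈ X := ⟨1, by simp⟩
  have hxN : ∀ g : G, x⁻¹ * (g * x * g⁻¹) ∈ N := by
    have h1 : (fun n => x * n) '' (N : Set G) = X := by
      apply Set.eq_of_subset_of_ncard_le
      · rintro _ ⟨n, hn, rfl⟩
        exact (hn x).2 hxX
      · rw [Set.ncard_image_of_injective _ (mul_right_injective _), hXc, ← hNc]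
        exact (Nat.card_coe_set_eq _).le
      · exact Set.toFinite _
    intro g
    have h2 : g * x * g⁻¹ ∈ X := ⟨g, rfl⟩
    rw [← h1] at h2
    obtain ⟨n, hn, h⟩ := h2
    dsimp only at h
    rw [← h, inv_mul_cancel_left]; exact hn
  have hNab : ∀ v ∈ N, ∀ m ∈ N, v * m = m * v := by
    intro v hv m hm
    by_cases h : v = 1
    · simp [h]
    obtain ⟨t, rfl⟩ := prime_fix hq hNc hv h hm
    exact (Commute.refl v).zpow_right t
  have hL : ∀ v : G, (∀ m ∈ N, v * m = m * v) → v ∈ C y := by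
    intro v hv
    by_contra hvy
    set n := v * y * v⁻¹ * y⁻¹ with hn
    have hnN : n ∈ N := hyN v
    have hn1 : n ≠ 1 := fun h => hvy (mem_C'.2 (mul_inv_eq_one.1 h))
    have hvn : Commute v n := hv n hnN
    have hpow : ∀ k : ℕ, v ^ k * y * (v ^ k)⁻¹ = n ^ k * y := by
      intro k
      induction k with
      | zero => simp
      | succ k ih =>
        calc v ^ (k+1) * y * (v ^ (k+1))⁻¹ = v * (v ^ k * y * (v ^ k)⁻¹) * v⁻¹ := by
              rw [pow_succ']; group
          _ = (v * n ^ k) * y * v⁻¹ := by rw [ih]; group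
          _ = n ^ k * (v * y * v⁻¹ * y⁻¹) * y := by rw [(hvn.pow_right k).eq]; group
          _ = _ := by rw [← hn, pow_succ]
    have hsub : (fun m => m * y) '' (N : Set G) ⊆ Set.range fun g => g * y * g⁻¹ := by
      rintro _ ⟨m, hm, rfl⟩
      have := prime_fix hq hNc hnN hn1 hm
      rw [← mem_powers_iff_mem_zpowers] at this
      obtain ⟨k, rfl⟩ := this
      exact ⟨v ^ k, hpow k⟩
    have := Set.ncard_le_ncard hsub
    rw [Set.ncard_image_of_injective _ (mul_left_injective _), ncard_class, hy] at this
    have h2 : (N : Set G).ncard = q := by rw [← hNc]; exact (Nat.card_coe_set_eq _).symm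
    omega
  have hsq : q = s := by
    obtain ⟨k, hk⟩ := hney
    set n := k * y * k⁻¹ * y⁻¹ with hn
    have hnN : n ∈ N := hyN k
    have hc : Commute n y := mem_C.1 (hL n (hNab n hnN))
    have h1 : k * y * k⁻¹ = n * y := by rw [hn]; group
    have h2 : (n * y) ^ (s ^ j) = 1 := by
      rw [← h1, conj_pow, ← oy, pow_orderOf_eq_one]; simp
    rw [hc.mul_pow, ← oy, pow_orderOf_eq_one, mul_one, oy] at h2
    have h3 : n ^ q = 1 := by
      have := pow_card_eq_one' (x := (⟨n, hnN⟩ : N))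
      rw [hNc] at this
      simpa [Subtype.ext_iff] using this
    have : Fact q.Prime := ⟨hq⟩
    have h4 := orderOf_eq_prime h3 hk
    have h5 : q ∣ s ^ j := h4 ▸ orderOf_dvd_of_pow_eq_one h2
    exact (Nat.prime_dvd_prime_iff_eq hq hs).1 (hq.dvd_of_dvd_pow h5)
  subst hsq
  have : Fact q.Prime := ⟨hq⟩
  obtain ⟨a, e, hax, oa⟩ : ∃ a : G, ∃ e, a ∉ C x ∧ orderOf a = q ^ e := by
    obtain ⟨S⟩ : Nonempty (Sylow q G) := inferInstance
    have : ¬ (S : Subgroup G) ≤ C x := by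
      intro hle
      have h := index_dvd_of_le hle
      rw [hx] at h
      exact S.not_dvd_index h
    obtain ⟨w, hw, hwK⟩ := SetLike.not_le_iff_exists.1 this
    obtain ⟨k, hk⟩ := IsPGroup.iff_orderOf.1 S.2 ⟨w, hw⟩
    exact ⟨w, k, hwK, by rw [← hk, Subgroup.orderOf_mk]⟩
  have haN : ∀ n ∈ N, a * n = n * a := fun n hn => prime_cent hq hNc oa hn
  by_cases hqa : q ∣ (C a).index
  · have hra : ¬ r ∣ (C a).index := fun h => hno a
      (((Nat.coprime_primes hq hr).2 hlt.ne').mul_dvd_of_dvd_of_dvd hqa h)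
    have hnle : ¬ C a ≤ C y := fun h => hra (hy ▸ index_dvd_of_le h)
    obtain ⟨v, hva, hvy⟩ := SetLike.not_le_iff_exists.1 hnle
    apply hvy
    apply hL
    have hdN := hxN a
    have hd1 : x⁻¹ * (a * x * a⁻¹) ≠ 1 := fun h => hax (mem_C'.2 (inv_mul_eq_one.1 h).symm)
    set d := x⁻¹ * (a * x * a⁻¹) with hd
    have hmN := hxN v
    set m := x⁻¹ * (v * x * v⁻¹) with hm
    have hvx : v * x * v⁻¹ = x * m := by rw [hm]; group
    have hva' : v * a * v⁻¹ = a := mem_C'.1 hva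
    have ham : a * m * a⁻¹ = m := by rw [haN m hmN]; group
    have hvd : v * d * v⁻¹ = d := by
      calc v * d * v⁻¹ = (v * x * v⁻¹)⁻¹ * ((v * a * v⁻¹) * (v * x * v⁻¹) * (v * a * v⁻¹)⁻¹) := by
            rw [hd]; group
        _ = m⁻¹ * (x⁻¹ * (a * x * a⁻¹)) * (a * m * a⁻¹) := by rw [hva', hvx]; group
        _ = m⁻¹ * (d * m) := by rw [ham, ← hd]; group
        _ = d := by rw [hNab d hdN m hmN]; group
    have hvd' : Commute v d := mul_inv_eq_iff_eq_mul.1 hvd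
    intro n hn
    obtain ⟨t, rfl⟩ := prime_fix hq hNc hdN hd1 hn
    exact hvd'.zpow_right t
  · obtain ⟨g, hg⟩ := conj_elt hq ox hqa
    apply hax
    have h1 := hxN g
    have h2 : Commute a (x⁻¹ * (g * x * g⁻¹)) := haN _ h1
    have h3 : Commute a (g * x * g⁻¹) := (mem_C.1 hg).symm
    have h4 : Commute a x := by
      have := h3.mul_right h2.inv_right
      simpa [mul_assoc] using this
    exact mem_C.2 h4

theorem caseB' {q r s i j : ℕ} (hq : q.Prime) (hr : r.Prime) (hs : s.Prime) (hne : q ≠ r)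
    (hno : ∀ g : G, ¬ q * r ∣ (C g).index) {x y : G} (hx : (C x).index = q) (hy : (C y).index = r)
    (ox : orderOf x = s ^ i) (oy : orderOf y = s ^ j) (hxy : x * y = y * x) : False := by
  rcases lt_or_gt_of_ne hne with h | h
  · exact caseB hr hq hs h (by simpa [mul_comm] using hno) hy hx oy ox hxy.symm
  · exact caseB hq hr hs h hno hx hy ox oy hxy

theorem exists_primary_sz {q : ℕ} (hq : q.Prime) {g : G} (hg : (C g).index = q) :
    ∃ s k, ∃ x : G, s.Prime ∧ orderOf x = s ^ k ∧ (C x).index = q := by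
  have h : ¬ zpowers g ≤ center G := by
    intro h
    have h1 := h (mem_zpowers g)
    have : C g = ⊤ := by
      rw [eq_top_iff]; intro k _
      rw [mem_C]; exact mem_center_iff.1 h1 k
    rw [this, index_top] at hg
    exact hq.ne_one hg.symm
  obtain ⟨u, k, hu, w, hw, hwc, ho⟩ := exists_primary h
  refine ⟨u, k, w, hu, ho, ?_⟩
  have h1 : C g ≤ C w := by
    obtain ⟨t, rfl⟩ := hw
    intro a ha
    have ha : Commute a g := mem_C.1 ha
    exact mem_C.2 (ha.zpow_right t)
  have h2 := index_dvd_of_le h1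
  rw [hg] at h2
  rcases (Nat.dvd_prime hq).1 h2 with h3 | h3
  · rw [index_eq_one] at h3
    refine absurd (mem_center_iff.2 fun k => ?_) hwc
    exact mem_C.1 (h3 ▸ mem_top k)
  · exact h3

theorem nocomm {q r : ℕ} (hq : q.Prime) (hr : r.Prime) (hne : q ≠ r)
    (hno : ∀ g : G, ¬ q * r ∣ (C g).index) {x y : G} (hx : q ∣ (C x).index) (hy : r ∣ (C y).index)
    (ho : (orderOf x).Coprime (orderOf y)) (hxy : x * y = y * x) : False := by
  have h := C_mul_eq hxy ho
  apply hno (x * y)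
  apply ((Nat.coprime_primes hq hr).2 hne).mul_dvd_of_dvd_of_dvd
  · exact hx.trans (index_dvd_of_le (h ▸ inf_le_left))
  · exact hy.trans (index_dvd_of_le (h ▸ inf_le_right))

theorem orderOf_conj' (g x : G) : orderOf (g * x * g⁻¹) = orderOf x := by
  exact MulEquiv.orderOf_eq (MulAut.conj g) x

theorem caseA {q r : ℕ} (hq : q.Prime) (hr : r.Prime) (hne : q ≠ r)
    (hno : ∀ g : G, ¬ q * r ∣ (C g).index) (hx : ∃ x : G, (C x).index = q)
    (hy : ∃ y : G, (C y).index = r) :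
    ∃ x y : G, ∃ i j, (C x).index = q ∧ (C y).index = r ∧ orderOf x = r ^ i ∧ orderOf y = q ^ j ∧
      x * y ≠ y * x := by
  obtain ⟨x, hx⟩ := hx
  obtain ⟨y, hy⟩ := hy
  obtain ⟨s, i, x, hs, ox, hx⟩ := exists_primary_sz hq hx
  obtain ⟨t, j, y, ht, oy, hy⟩ := exists_primary_sz hr hy
  by_cases hst : s = t
  · exfalso
    subst hst
    by_cases hsq : s = q
    · subst hsq
      obtain ⟨g, hg⟩ := conj_elt hs ox (H := C y) (by
        rw [hy, Nat.prime_dvd_prime_iff_eq hs hr]; exact hne)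
      exact caseB' hq hr hs hne hno ((sz_conj x g).trans hx) hy ((orderOf_conj' g x).trans ox) oy
        (mem_C.1 hg)
    · obtain ⟨g, hg⟩ := conj_elt hs oy (H := C x) (by
        rw [hx, Nat.prime_dvd_prime_iff_eq hs hq]; exact hsq)
      exact caseB' hq hr hs hne hno hx ((sz_conj y g).trans hy) ox ((orderOf_conj' g y).trans oy)
        (mem_C.1 hg).symm
  · have hco : (s ^ i).Coprime (t ^ j) := Nat.Coprime.pow _ _ ((Nat.coprime_primes hs ht).2 hst)
    have htq : t = q := by
      by_contra h
      obtain ⟨g, hg⟩ := conj_elt ht oy (H := C x) (by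
        rw [hx, Nat.prime_dvd_prime_iff_eq ht hq]; exact h)
      exact nocomm hq hr hne hno hx.symm.dvd ((sz_conj y g).trans hy).symm.dvd
        (by rw [orderOf_conj', ox, oy]; exact hco) (mem_C.1 hg).symm
    have hsr : s = r := by
      by_contra h
      obtain ⟨g, hg⟩ := conj_elt hs ox (H := C y) (by
        rw [hy, Nat.prime_dvd_prime_iff_eq hs hr]; exact h)
      exact nocomm hq hr hne hno ((sz_conj x g).trans hx).symm.dvd hy.symm.dvd
        (by rw [orderOf_conj', ox, oy]; exact hco) (mem_C.1 hg)
    subst htq hsr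
    exact ⟨x, y, i, j, hx, hy, ox, oy, fun h => nocomm hq hr hne hno hx.symm.dvd hy.symm.dvd
      (by rw [ox, oy]; exact hco) h⟩

/-- a `w` of prime power order commuting with `x` -/
theorem le_of_comm {q r : ℕ} (hq : q.Prime)
    (hsz : ∀ g : G, (C g).index = 1 ∨ (C g).index = q ∨ (C g).index = r)
    (hqr : ¬ q ∣ r)
    {x w : G} (hx : (C x).index = q) (hc : x * w = w * x) (ho : (orderOf x).Coprime (orderOf w)) :
    C x ≤ C w := by
  have h := C_mul_eq hc ho
  have h1 : (C x).index ∣ (C (x * w)).index := index_dvd_of_le (h ▸ inf_le_left)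
  have h2 : (C (x * w)).index = q := by
    rw [hx] at h1
    rcases hsz (x * w) with e | e | e
    · rw [e] at h1; exact absurd (Nat.dvd_one.1 h1) hq.ne_one
    · exact e
    · rw [e] at h1; exact absurd h1 hqr
  rw [h, ← hx] at h2
  have h3 : C x ⊓ C w = C x := by
    have h4 := relIndex_mul_index (inf_le_left : C x ⊓ C w ≤ C x)
    rw [h2] at h4
    have h5 : (C x ⊓ C w).relIndex (C x) = 1 := by
      have : (C x).index ≠ 0 := FiniteIndex.index_ne_zero
      exact (Nat.mul_eq_right this).1 h4
    exact le_antisymm inf_le_left (relIndex_eq_one.1 h5)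
  exact inf_eq_left.1 h3

theorem part2 {q r : ℕ} (hq : q.Prime) (hr : r.Prime) (hne : q ≠ r)
    (hsz : ∀ g : G, (C g).index = 1 ∨ (C g).index = q ∨ (C g).index = r)
    (hx : ∃ x : G, (C x).index = q)
    (hy : ∃ y : G, (C y).index = r) :
    Nat.card (G ⧸ center G) = q * r ∧ ¬ ∀ x y : G ⧸ center G, x * y = y * x := by
  have hqr : ¬ q ∣ r := by rw [Nat.prime_dvd_prime_iff_eq hq hr]; exact hne
  have hrq : ¬ r ∣ q := by rw [Nat.prime_dvd_prime_iff_eq hr hq]; exact hne.symm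
  have hno : ∀ g : G, ¬ q * r ∣ (C g).index := by
    intro g h
    rcases hsz g with e | e | e <;> rw [e] at h
    · exact hq.ne_one (Nat.dvd_one.1 (dvd_of_mul_right_dvd h))
    · exact hrq (dvd_of_mul_left_dvd h)
    · exact hqr (dvd_of_mul_right_dvd h)
  obtain ⟨x, y, i, j, hx, hy, ox, oy, hxy⟩ := caseA hq hr hne hno hx hy
  have hcop : (C x).index.Coprime (C y).index := by
    rw [hx, hy]; exact (Nat.coprime_primes hq hr).2 hne
  have hsz' : ∀ g : G, (C g).index = 1 ∨ (C g).index = r ∨ (C g).index = q := fun g => by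
    have := hsz g; tauto
  have copp : ∀ {a b c d : ℕ}, a.Prime → b.Prime → a ≠ b → (a ^ c).Coprime (b ^ d) :=
    fun ha hb h => Nat.Coprime.pow _ _ ((Nat.coprime_primes ha hb).2 h)
  have hcent : C x ⊓ C y ≤ center G := by
    by_contra hcon
    obtain ⟨u, k, hu, w, ⟨hwx, hwy⟩, hwc, ow⟩ := exists_primary hcon
    have hX : u ≠ r → C x ≤ C w := fun h => le_of_comm hq hsz hqr hx (mem_C.1 hwx).symm
      (by rw [ox, ow]; exact copp hr hu h.symm)
    have hY : u ≠ q → C y ≤ C w := fun h => le_of_comm hr hsz' hrq hy (mem_C.1 hwy).symm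
      (by rw [oy, ow]; exact copp hq hu h.symm)
    have hCw : (C w).index ≠ 1 := by
      intro h
      rw [index_eq_one] at h
      exact hwc (mem_center_iff.2 fun k => mem_C.1 (h ▸ mem_top k))
    have key : ∀ {z : G} {q : ℕ}, q.Prime → (C z).index = q → C z ≤ C w → C w ≤ C z := by
      intro z q hq hz hle
      have h4 := relIndex_mul_index hle
      rw [hz] at h4
      have h5 : (C w).index = q := ((Nat.dvd_prime hq).1 (Dvd.intro_left _ h4)).resolve_left hCw
      rw [h5] at h4
      exact relIndex_eq_one.1 ((Nat.mul_eq_right hq.ne_zero).1 h4)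
    by_cases hur : u = r
    · have h1 := hY (by rw [hur]; exact hne.symm)
      have h2 := key hr hy h1 (C_symm.1 hwx)
      exact hxy (mem_C.1 h2)
    · have h1 := hX hur
      have h2 := key hq hx h1 (C_symm.1 hwy)
      exact hxy (mem_C.1 h2).symm
  have hceq : C x ⊓ C y = center G := by
    apply le_antisymm hcent
    exact le_inf (center_le_centralizer _) (center_le_centralizer _)
  constructor
  · rw [← hx, ← hy, ← index_inf_coprime hcop, hceq]; rfl
  · intro hab
    have h1 := hab (x : G ⧸ center G) (y : G ⧸ center G)
    have h2 : (x * y)⁻¹ * (y * x) ∈ center G := QuotientGroup.eq.1 h1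
    set z := (x * y)⁻¹ * (y * x) with hz
    have hyz : x⁻¹ * y * x = y * z := by rw [hz]; group
    have hzc : ∀ g, Commute g z := fun g => mem_center_iff.1 h2 g
    have e1 : z ^ (q ^ j) = 1 := by
      have : (x⁻¹ * y * x) ^ (q ^ j) = 1 := by
        have := orderOf_conj' x⁻¹ y
        rw [inv_inv, oy] at this
        rw [← this, pow_orderOf_eq_one]
      rw [hyz, (hzc y).mul_pow, ← oy, pow_orderOf_eq_one, one_mul] at this
      rw [← oy]; exact this
    have hxz : y⁻¹ * x * y = x * z⁻¹ := by
      rw [hz]; group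
    have e2 : z ^ (r ^ i) = 1 := by
      have : (y⁻¹ * x * y) ^ (r ^ i) = 1 := by
        have := orderOf_conj' y⁻¹ x
        rw [inv_inv, ox] at this
        rw [← this, pow_orderOf_eq_one]
      rw [hxz, (hzc x).inv_right.mul_pow, ← ox, pow_orderOf_eq_one, one_mul, inv_pow, inv_eq_one] at this
      rw [← ox]; exact this
    have e3 : z = 1 := by
      rw [← orderOf_eq_one_iff]
      exact Nat.eq_one_of_dvd_coprimes (copp hq hr hne) (orderOf_dvd_of_pow_eq_one e1)
        (orderOf_dvd_of_pow_eq_one e2)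
    exact hxy (inv_mul_eq_one.1 (hz ▸ e3))

theorem pgroup_cover {p : ℕ} (hp : p.Prime) (hG : IsPGroup p G) (H : Subgroup G)
    (h : ∀ w : G, ∃ l : G, l * w * l⁻¹ ∈ H) : H = ⊤ := by
  have : Fact p.Prime := ⟨hp⟩
  have := hG.isNilpotent
  rcases eq_top_or_exists_le_coatom H with h1 | ⟨M, hM, hHM⟩
  · exact h1
  have hn := NormalizerCondition.normal_of_coatom M Group.normalizerCondition_of_isNilpotent hM
  exfalso
  apply hM.1
  rw [eq_top_iff]
  intro w _
  obtain ⟨l, hl⟩ := h w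
  have := hn.conj_mem _ (hHM hl) l⁻¹
  have e : l⁻¹ * (l * w * l⁻¹) * l⁻¹⁻¹ = w := by group
  rwa [e] at this

open scoped commutatorElement in
theorem pgroup_class {p : ℕ} (hp : p.Prime) (hG : IsPGroup p G)
    (h : ∀ w : G, (C w).index = 1 ∨ (C w).index = p) (x y a : G) : a * ⁅x, y⁆ = ⁅x, y⁆ * a := by
  have : Fact p.Prime := ⟨hp⟩
  rcases h a with h1 | h1
  · rw [index_eq_one] at h1
    have : ⁅x, y⁆ ∈ C a := h1 ▸ mem_top _
    exact (mem_C.1 this).symm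
  · have hn : (C a).Normal := by
      apply normal_of_index_eq_minFac_card
      obtain ⟨n, hn⟩ := IsPGroup.iff_card.1 hG
      have hn0 : n ≠ 0 := by
        rintro rfl
        have := (C a).index_dvd_card
        rw [h1, hn, pow_zero, Nat.dvd_one] at this
        exact hp.ne_one this
      rw [h1, hn, hp.pow_minFac hn0]
    have hc : IsCyclic (G ⧸ C a) := isCyclic_of_prime_card (p := p) h1
    have hcm : IsMulCommutative (G ⧸ C a) := inferInstance
    have := Normal.quotient_commutative_iff_commutator_le.1 hcm
    have := this (commutator_mem_commutator (mem_top x) (mem_top y))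
    exact (mem_C.1 this).symm

theorem sz_p {p q r : ℕ} (hp : p.Prime) (hq : q.Prime) (hr : r.Prime) (hpq : p ≠ q) (hpr : p ≠ r)
    (hqr : q ≠ r)
    (hsz : ∀ g : G, (C g).index = 1 ∨ (C g).index = p ∨ (C g).index = q ∨ (C g).index = r ∨
      (C g).index = p * q ∨ (C g).index = p * r)
    (hx : ∃ x : G, (C x).index = q) (hy : ∃ y : G, (C y).index = r) {w : G} {k : ℕ}
    (ow : orderOf w = p ^ k) : (C w).index = 1 ∨ (C w).index = p := by
  have nd : ∀ {a b : ℕ}, a.Prime → b.Prime → a ≠ b → ¬ a ∣ b := fun ha hb h => by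
    rwa [Nat.prime_dvd_prime_iff_eq ha hb]
  have copp : ∀ {a b c d : ℕ}, a.Prime → b.Prime → a ≠ b → (a ^ c).Coprime (b ^ d) :=
    fun ha hb h => Nat.Coprime.pow _ _ ((Nat.coprime_primes ha hb).2 h)
  have hno : ∀ g : G, ¬ q * r ∣ (C g).index := by
    intro g h
    have h1 : q ∣ (C g).index := dvd_of_mul_right_dvd h
    have h2 : r ∣ (C g).index := dvd_of_mul_left_dvd h
    rcases hsz g with e | e | e | e | e | e <;> rw [e] at h1 h2
    · exact hq.ne_one (Nat.dvd_one.1 h1)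
    · exact nd hq hp hpq.symm h1
    · exact nd hr hq hqr.symm h2
    · exact nd hq hr hqr h1
    · exact ((hr.dvd_mul).1 h2).elim (nd hr hp hpr.symm) (nd hr hq hqr.symm)
    · exact ((hq.dvd_mul).1 h1).elim (nd hq hp hpq.symm) (nd hq hr hqr)
  obtain ⟨x, y, i, j, hx, hy, ox, oy, hxy⟩ := caseA hq hr hqr hno hx hy
  have hrw : ¬ r ∣ (C w).index := by
    intro h
    obtain ⟨g, hg⟩ := conj_elt hp ow (H := C x) (by rw [hx]; exact nd hp hq hpq)
    exact nocomm hq hr hqr hno hx.symm.dvd (by rw [sz_conj]; exact h)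
      (by rw [orderOf_conj', ox, ow]; exact copp hr hp hpr.symm) (mem_C.1 hg).symm
  have hqw : ¬ q ∣ (C w).index := by
    intro h
    obtain ⟨g, hg⟩ := conj_elt hp ow (H := C y) (by rw [hy]; exact nd hp hr hpr)
    exact nocomm hq hr hqr hno (x := g * w * g⁻¹) (by rw [sz_conj]; exact h) hy.symm.dvd
      (by rw [orderOf_conj', oy, ow]; exact copp hp hq hpq) (mem_C.1 hg)
  rcases hsz w with e | e | e | e | e | e
  · exact Or.inl e
  · exact Or.inr e
  · exact absurd e.symm.dvd hqw
  · exact absurd e.symm.dvd hrw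
  · exact absurd (Dvd.intro_left _ e.symm) hqw
  · exact absurd (Dvd.intro_left _ e.symm) hrw

theorem split {p : ℕ} (hp : p.Prime)
    (hsz : ∀ (w : G) (k : ℕ), orderOf w = p ^ k → (C w).index = 1 ∨ (C w).index = p) :
    ∃ P K : Subgroup G, IsPGroup p P ∧ ¬ p ∣ Nat.card K ∧ IsComplement' P K ∧
      ∀ a ∈ P, ∀ b ∈ K, a * b = b * a := by
  have : Fact p.Prime := ⟨hp⟩
  obtain ⟨P⟩ : Nonempty (Sylow p G) := inferInstance
  have hsz' : ∀ w ∈ (P : Subgroup G), (C w).index = 1 ∨ (C w).index = p := by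
    intro w hw
    obtain ⟨k, hk⟩ := IsPGroup.iff_orderOf.1 P.2 ⟨w, hw⟩
    exact hsz w k (by rw [← hk, Subgroup.orderOf_mk])
  have hcj : ∀ w ∈ (P : Subgroup G), ∀ g : G, ∃ l ∈ (P : Subgroup G), l * w * l⁻¹ = g * w * g⁻¹ := by
    intro w hw g
    have hco : (P : Subgroup G).index.Coprime (C w).index := by
      rcases hsz' w hw with h | h <;> rw [h]
      · exact Nat.coprime_one_right _
      · exact ((Nat.Prime.coprime_iff_not_dvd hp).2 P.not_dvd_index).symm
    obtain ⟨l, h1, h2⟩ := pair_trans hco 1 g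
    refine ⟨l, by simpa using h1, ?_⟩
    rw [mem_C] at h2
    calc l * w * l⁻¹ = g * (g⁻¹ * l * w) * l⁻¹ := by group
      _ = _ := by rw [h2]; group
  have hPn : (P : Subgroup G).Normal := by
    constructor
    intro w hw g
    obtain ⟨l, hl, h⟩ := hcj w hw g
    rw [← h]
    exact mul_mem (mul_mem hl hw) (inv_mem hl)
  obtain ⟨K, hK⟩ := exists_right_complement'_of_coprime P.card_coprime_index
  have hKc : ¬ p ∣ Nat.card K := by
    rw [← hK.symm.index_eq_card]; exact P.not_dvd_index
  refine ⟨P, K, P.2, hKc, hK, ?_⟩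
  have hle : K ≤ centralizer ((P : Subgroup G) : Set G) := by
    by_contra hcon
    obtain ⟨u, e, hu, k, hk, hkc, ok⟩ := exists_primary hcon
    apply hkc
    have hup : u ≠ p ∨ e = 0 := by
      by_cases he : e = 0
      · exact Or.inr he
      · left
        rintro rfl
        apply hKc
        have h1 : orderOf k ∣ Nat.card K := by
          have := orderOf_dvd_natCard (⟨k, hk⟩ : K)
          rwa [Subgroup.orderOf_mk] at this
        rw [ok] at h1
        exact (dvd_pow_self _ he).trans h1
    have hup : u ≠ p := by
      rcases hup with h | h
      · exact h
      · exfalso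
        rw [h, pow_zero, orderOf_eq_one_iff] at ok
        exact hkc (ok ▸ one_mem _)
    have hcov := pgroup_cover hp P.2 ((C k).subgroupOf (P : Subgroup G)) (by
      rintro ⟨w, hw⟩
      have hu' : ¬ u ∣ (C w).index := by
        rcases hsz' w hw with h | h <;> rw [h]
        · rw [Nat.dvd_one]; exact hu.ne_one
        · rwa [Nat.prime_dvd_prime_iff_eq hu hp]
      obtain ⟨g, hg⟩ := conj_elt hu ok hu'
      obtain ⟨l, hl, h⟩ := hcj w hw g⁻¹
      refine ⟨⟨l, hl⟩, ?_⟩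
      rw [mem_subgroupOf]
      change l * w * l⁻¹ ∈ C k
      rw [h, mem_C]
      rw [mem_C] at hg
      calc g⁻¹ * w * g⁻¹⁻¹ * k = g⁻¹ * (w * (g * k * g⁻¹)) * g := by group
        _ = _ := by rw [← hg]; group)
    rw [subgroupOf_eq_top] at hcov
    rw [mem_centralizer_iff]
    intro w hw
    exact mem_C.1 (hcov hw)
  intro a ha b hb
  exact (mem_centralizer_iff.1 (hle hb)) a ha

end

theorem sz_equiv {G H : Type*} [Group G] [Group H] (e : G ≃* H) (g : G) :
    (C (e g)).index = (C g).index := by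
  have : C g = (C (e g)).comap e.toMonoidHom := by
    ext h
    rw [mem_comap, mem_C, mem_C]
    change _ ↔ e h * e g = e g * e h
    rw [← map_mul, ← map_mul, e.injective.eq_iff]
  rw [this, index_comap_of_surjective]
  exact e.surjective

theorem sz_prod {G H : Type*} [Group G] [Group H] (a : G) (b : H) :
    (C (a, b)).index = (C a).index * (C b).index := by
  rw [← index_prod]
  congr 1
  ext ⟨x, y⟩
  rw [mem_prod, mem_C, mem_C, mem_C]
  simp

theorem sz_one {G : Type*} [Group G] : (C (1 : G)).index = 1 := by
  rw [index_eq_one, eq_top_iff]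
  intro k _
  rw [mem_C]; simp

end Stmt2Aux

/-- If `cs(G) = {1, p₁, p₂, p₃, m, n}` with `p₁, p₂, p₃` distinct primes and `m = p₁p₂`,
`n = p₁p₃` the unique composite members of `cs(G)`, then `G` is an internal direct product
`G = A × P × H` with `A` abelian, `P` a `p₁`-group of nilpotency class at most `2` with
`cs(P) = {1, p₁}`, and `cs(H) = {1, p₂, p₃}` with `H/Z(H)` a nonabelian group of order
`p₂·p₃`. -/
theorem stmt_2 (G : Type*) [Group G] [Finite G] (p₁ p₂ p₃ m n : ℕ)
    (hp₁ : p₁.Prime) (hp₂ : p₂.Prime) (hp₃ : p₃.Prime)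
    (h12 : p₁ ≠ p₂) (h13 : p₁ ≠ p₃) (h23 : p₂ ≠ p₃)
    (hm : m = p₁ * p₂) (hn : n = p₁ * p₃)
    (hcs : csSet G = {1, p₁, p₂, p₃, m, n})
    (huniq : ∀ x ∈ csSet G, IsCompositeNat x → x = m ∨ x = n) :
    ∃ A P H : Subgroup G,
      (∀ x ∈ A, ∀ y ∈ A, x * y = y * x) ∧
      IsPGroup p₁ P ∧
      lowerCentralSeries P 2 = ⊥ ∧
      csSet P = {1, p₁} ∧
      csSet H = {1, p₂, p₃} ∧
      Nat.card (H ⧸ Subgroup.center H) = p₂ * p₃ ∧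
      (¬ ∀ x y : H ⧸ Subgroup.center H, x * y = y * x) ∧
      ∃ e : (A × P × H) ≃* G, ∀ (a : A) (p : P) (h : H), e (a, p, h) = (a : G) * p * h := by
  have nd : ∀ {a b : ℕ}, a.Prime → b.Prime → a ≠ b → ¬ a ∣ b := fun ha hb h => by
    rwa [Nat.prime_dvd_prime_iff_eq ha hb]
  have hsz : ∀ g : G, (Stmt2Aux.C g).index = 1 ∨ (Stmt2Aux.C g).index = p₁ ∨
      (Stmt2Aux.C g).index = p₂ ∨ (Stmt2Aux.C g).index = p₃ ∨
      (Stmt2Aux.C g).index = p₁ * p₂ ∨ (Stmt2Aux.C g).index = p₁ * p₃ := by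
    intro g
    have : (Stmt2Aux.C g).index ∈ csSet G := ⟨g, rfl⟩
    rw [hcs, hm, hn] at this
    simpa using this
  have hex : ∀ k ∈ csSet G, ∃ g : G, (Stmt2Aux.C g).index = k := fun k ⟨g, hg⟩ => ⟨g, hg.symm⟩
  have ex1 := hex p₁ (by rw [hcs]; simp)
  have ex2 := hex p₂ (by rw [hcs]; simp)
  have ex3 := hex p₃ (by rw [hcs]; simp)
  obtain ⟨P, K, hP, hK, hPK, hcomm⟩ := Stmt2Aux.split (G := G) hp₁ (fun w k ow =>
    Stmt2Aux.sz_p hp₁ hp₂ hp₃ h12 h13 h23 hsz ex2 ex3 ow)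
  have : Fact p₁.Prime := ⟨hp₁⟩
  have hcomm' : ∀ (a : P) (b : K), (a : G) * b = b * a := fun a b => hcomm a a.2 b b.2
  let f : P × K →* G :=
    { toFun := fun t => (t.1 : G) * t.2
      map_one' := by simp
      map_mul' := by
        rintro ⟨a, b⟩ ⟨c, d⟩
        simp only [Prod.mk_mul_mk, Subgroup.coe_mul]
        rw [mul_assoc, ← mul_assoc (c : G) b d, hcomm' c b]; group }
  let e0 : P × K ≃* G := MulEquiv.ofBijective f hPK
  have hi : ∀ (a : P) (b : K), (Stmt2Aux.C (e0 (a, b))).index =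
      (Stmt2Aux.C a).index * (Stmt2Aux.C b).index := fun a b => by
    rw [Stmt2Aux.sz_equiv, Stmt2Aux.sz_prod]
  have hPi : ∀ (a : P) (u : ℕ), u.Prime → u ≠ p₁ → ¬ u ∣ (Stmt2Aux.C a).index := by
    intro a u hu hne h
    obtain ⟨k, hk⟩ := hP.index (Stmt2Aux.C a)
    rw [hk] at h
    exact nd hu hp₁ hne (hu.dvd_of_dvd_pow h)
  have hKi : ∀ (b : K), ¬ p₁ ∣ (Stmt2Aux.C b).index := fun b h =>
    hK (h.trans (Subgroup.index_dvd_card _))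
  have hPsz : ∀ a : P, (Stmt2Aux.C a).index = 1 ∨ (Stmt2Aux.C a).index = p₁ := by
    intro a
    have h1 := hi a 1
    rw [Stmt2Aux.sz_one, mul_one] at h1
    have h2 := hPi a p₂ hp₂ h12.symm
    have h3 := hPi a p₃ hp₃ h13.symm
    rcases hsz (e0 (a, 1)) with e | e | e | e | e | e <;> rw [h1] at e
    · exact Or.inl e
    · exact Or.inr e
    · exact absurd e.symm.dvd h2
    · exact absurd e.symm.dvd h3
    · exact absurd (Dvd.intro_left _ e.symm) h2
    · exact absurd (Dvd.intro_left _ e.symm) h3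
  have hKsz : ∀ b : K, (Stmt2Aux.C b).index = 1 ∨ (Stmt2Aux.C b).index = p₂ ∨
      (Stmt2Aux.C b).index = p₃ := by
    intro b
    have h1 := hi 1 b
    rw [Stmt2Aux.sz_one, one_mul] at h1
    have h2 := hKi b
    rcases hsz (e0 (1, b)) with e | e | e | e | e | e <;> rw [h1] at e
    · exact Or.inl e
    · exact absurd e.symm.dvd h2
    · exact Or.inr (Or.inl e)
    · exact Or.inr (Or.inr e)
    · exact absurd (Dvd.intro _ e.symm) h2
    · exact absurd (Dvd.intro _ e.symm) h2
  have hPex : ∃ a : P, (Stmt2Aux.C a).index = p₁ := by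
    obtain ⟨g, hg⟩ := ex1
    obtain ⟨⟨a, b⟩, rfl⟩ := e0.surjective g
    rw [hi] at hg
    refine ⟨a, (hPsz a).resolve_left fun h => ?_⟩
    rw [h, one_mul] at hg
    exact hKi b hg.symm.dvd
  have hKex : ∀ u : ℕ, u.Prime → u ≠ p₁ → (∃ g : G, (Stmt2Aux.C g).index = u) →
      ∃ b : K, (Stmt2Aux.C b).index = u := by
    rintro u hu hne ⟨g, hg⟩
    obtain ⟨⟨a, b⟩, rfl⟩ := e0.surjective g
    rw [hi] at hg
    refine ⟨b, ?_⟩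
    rcases hPsz a with h | h <;> rw [h] at hg
    · rwa [one_mul] at hg
    · exact absurd (Dvd.intro _ hg) (nd hp₁ hu hne.symm)
  have hK2 := hKex p₂ hp₂ h12.symm ex2
  have hK3 := hKex p₃ hp₃ h13.symm ex3
  obtain ⟨hc1, hc2⟩ := Stmt2Aux.part2 hp₂ hp₃ h23 hKsz hK2 hK3
  refine ⟨⊥, P, K, ?_, hP, ?_, ?_, ?_, hc1, hc2, ?_⟩
  · intro x hx y hy
    rw [Subgroup.mem_bot] at hx hy
    rw [hx, hy]
  · change ⁅⁅P, P⁆, P⁆ = ⊥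
    rw [Subgroup.commutator_eq_bot_iff_le_centralizer, Subgroup.commutator_le]
    intro x hx y hy
    rw [Subgroup.mem_centralizer_iff]
    intro a ha
    exact congrArg Subtype.val
      (Stmt2Aux.pgroup_class hp₁ hP hPsz ⟨x, hx⟩ ⟨y, hy⟩ ⟨a, ha⟩)
  · ext k
    simp only [Set.mem_insert_iff, Set.mem_singleton_iff]
    constructor
    · rintro ⟨a, rfl⟩
      exact hPsz a
    · rintro (rfl | rfl)
      · exact ⟨1, Stmt2Aux.sz_one.symm⟩
      · obtain ⟨a, ha⟩ := hPex
        exact ⟨a, ha.symm⟩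
  · ext k
    simp only [Set.mem_insert_iff, Set.mem_singleton_iff]
    constructor
    · rintro ⟨a, rfl⟩
      exact hKsz a
    · rintro (rfl | rfl | rfl)
      · exact ⟨1, Stmt2Aux.sz_one.symm⟩
      · obtain ⟨a, ha⟩ := hK2
        exact ⟨a, ha.symm⟩
      · obtain ⟨a, ha⟩ := hK3
        exact ⟨a, ha.symm⟩
  · refine ⟨(MulEquiv.uniqueProd (M := P × K) (N := (⊥ : Subgroup G))).trans e0, ?_⟩
    intro a p h
    have ha : (a : G) = 1 := Subgroup.mem_bot.1 a.2
    rw [ha, one_mul]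
    rfl
end
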